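/- arXiv:1607.03698 — 3 statements merged into one kernel-verified Lean document; each statement's English description precedes it below -/
import Mathlib

section
/- Let n ≥ 2 and let (u_1, …, u_n) be distributed uniformly on Π_n (i.e., according to the normalized (n−1)-dimensional volume measure on Π_n). Then the marginal distributions of the coordinates u_i are identical and absolutely continuous with respect to Lebesgue measure on [0,1], with density l_n(u) = ((n−1)/n^{n−2}) · Vol_{n−2}( P_{n−1}(n−1, n−2, …, j+1, 2j−1−(n−1)u, j−2, …, 0) ) for u ∈ [(j−1)/(n−1), j/(n−1)], j = 1, …, n−1. -/
open MeasureTheory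

/-- The permutohedron `P_m(x)` in Euclidean space. -/
noncomputable def permutohedronE (m : ℕ) (x : EuclideanSpace ℝ (Fin m)) :
    Set (EuclideanSpace ℝ (Fin m)) :=
  convexHull ℝ {y | ∃ σ : Equiv.Perm (Fin m), ∀ i, y i = x (σ i)}

/-- The permutohedron `P_m(x)` in plain `ℝ^m`. -/
noncomputable def permutohedron (m : ℕ) (x : Fin m → ℝ) : Set (Fin m → ℝ) :=
  convexHull ℝ {y | ∃ σ : Equiv.Perm (Fin m), ∀ i, y i = x (σ i)}

/-- The scaled regular permutohedron `Π_n = P_n(1, (n-2)/(n-1), …, 1/(n-1), 0)`. -/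
noncomputable def regularPermE (n : ℕ) : Set (EuclideanSpace ℝ (Fin n)) :=
  permutohedronE n
    ((WithLp.equiv 2 (Fin n → ℝ)).symm fun i => ((n : ℝ) - 1 - (i : ℕ)) / ((n : ℝ) - 1))

/-- The uniform distribution on `Π_n`: the normalized `(n-1)`-dimensional Hausdorff
measure restricted to `Π_n`. -/
noncomputable def uniformPerm (n : ℕ) : Measure (EuclideanSpace ℝ (Fin n)) :=
  (μH[(n : ℝ) - 1] (regularPermE n))⁻¹ • (μH[(n : ℝ) - 1]).restrict (regularPermE n)

/-- `Vol_{m-1}` of subsets of `ℝ^m`: Lebesgue measure of the projection deleting the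
last coordinate. -/
noncomputable def permVol (m : ℕ) (S : Set (Fin m → ℝ)) : ℝ :=
  (volume ((fun (y : Fin m → ℝ) (i : Fin (m - 1)) => y (Fin.castLE (Nat.sub_le m 1) i)) ''
    S)).toReal

/-- The vector `(n-1, n-2, …, j+1, 2j-1-(n-1)u, j-2, …, 0)` in `ℝ^{n-1}`. -/
noncomputable def sectionVec (n j : ℕ) (u : ℝ) : Fin (n - 1) → ℝ := fun i =>
  if (i : ℕ) < n - 1 - j then (n : ℝ) - 1 - (i : ℕ)
  else if (i : ℕ) = n - 1 - j then 2 * (j : ℝ) - 1 - ((n : ℝ) - 1) * u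
  else (n : ℝ) - 2 - (i : ℕ)

namespace PermAux

/-- support-function description of the permutohedron -/
lemma mem_iff {n : ℕ} (x v : Fin n → ℝ) : v ∈ permutohedron n x ↔
    ∀ c : Fin n → ℝ, ∃ σ : Equiv.Perm (Fin n), ∑ i, c i * v i ≤ ∑ i, c i * x (σ i) := by
  constructor
  · intro hv c
    obtain ⟨σ, hσ⟩ := Finite.exists_max (fun σ : Equiv.Perm (Fin n) => ∑ i, c i * x (σ i))
    refine ⟨σ, ?_⟩
    have hconv : Convex ℝ {y : Fin n → ℝ | ∑ i, c i * y i ≤ ∑ i, c i * x (σ i)} := by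
      apply convex_halfSpace_le
      exact ⟨fun a b => by simp [mul_add, Finset.sum_add_distrib],
        fun a b => by simp [Finset.mul_sum, mul_left_comm]⟩
    refine convexHull_min ?_ hconv hv
    rintro y ⟨τ, hτ⟩
    simp only [Set.mem_ofPred_eq, hτ]
    exact hσ τ
  · intro h
    by_contra hv
    have hfin : {y : Fin n → ℝ | ∃ σ : Equiv.Perm (Fin n), ∀ i, y i = x (σ i)}.Finite := by
      refine (Set.finite_range (fun σ : Equiv.Perm (Fin n) => fun i => x (σ i))).subset ?_
      rintro y ⟨σ, hσ⟩
      exact ⟨σ, by ext i; simp [hσ]⟩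
    obtain ⟨f, u, hf1, hf2⟩ := geometric_hahn_banach_closed_point
      (convex_convexHull ℝ _) (hfin.isClosed_convexHull ℝ) hv
    have hfv : ∀ y : Fin n → ℝ, f y = ∑ i, f (Pi.single i 1) * y i := by
      intro y
      conv_lhs => rw [pi_eq_sum_univ' y]
      rw [map_sum]
      refine Finset.sum_congr rfl fun i _ => ?_
      rw [map_smul, smul_eq_mul, mul_comm]
    obtain ⟨σ, hσ⟩ := h (fun i => f (Pi.single i 1))
    have h1 := hf1 (fun i => x (σ i)) (subset_convexHull ℝ _ ⟨σ, fun i => rfl⟩)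
    rw [hfv] at h1 hf2
    linarith

lemma mem_of_antitone {n : ℕ} (x v : Fin n → ℝ)
    (h : ∀ c : Fin n → ℝ, Antitone c → ∀ τ : Equiv.Perm (Fin n),
      ∑ i, c i * v (τ i) ≤ ∑ i, c i * x i) : v ∈ permutohedron n x := by
  rw [mem_iff]
  intro c
  let τ := Tuple.sort (fun i => - c i)
  have hτ : Antitone (c ∘ τ) := by
    intro a b hab
    have := Tuple.monotone_sort (fun i => - c i) hab
    simpa using this
  refine ⟨τ⁻¹, ?_⟩
  have := h _ hτ τ
  rw [← Equiv.sum_comp τ (fun i => c i * v i), ← Equiv.sum_comp τ (fun i => c i * x (τ⁻¹ i))]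
  simpa using this

/-- the vector `(n-1, …, 0)` -/
noncomputable def x0 (n : ℕ) : Fin n → ℝ := fun i => (n : ℝ) - 1 - (i : ℕ)

lemma x0_antitone (n : ℕ) : Antitone (x0 n) := by
  intro a b hab
  have : ((a : ℕ) : ℝ) ≤ (b : ℕ) := by exact_mod_cast hab
  simp only [x0]; linarith

lemma sec_castSucc (k j : ℕ) (h1 : 1 ≤ j) (h2 : j ≤ k + 1) (u : ℝ) (p : Fin (k + 1))
    (hp : (p : ℕ) = k + 1 - j) (i : Fin (k + 1)) :
    x0 (k + 2) (p.castSucc.succAbove i) = sectionVec (k + 2) j u i +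
      if i = p then (k + 1) * u - j else 0 := by
  obtain ⟨d, hd⟩ : ∃ d, k + 1 = j + d := ⟨_, (Nat.add_sub_cancel' h2).symm⟩
  have hpd : (p : ℕ) = d := by omega
  have hk : (k : ℝ) + 1 = j + d := by exact_mod_cast hd
  have e : k + 2 - 1 - j = d := by omega
  simp only [x0, sectionVec, e]
  rcases lt_trichotomy (i : ℕ) d with h | h | h
  · rw [Fin.succAbove_of_castSucc_lt _ _ (by rw [Fin.lt_def]; simp; omega)]
    have : i ≠ p := by intro hprime; subst hprime; omega
    simp [h, this]
  · have : i = p := Fin.ext (by omega)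
    rw [Fin.succAbove_of_le_castSucc _ _ (by rw [Fin.le_def]; simp; omega)]
    simp [h, this, hpd]
    linarith
  · rw [Fin.succAbove_of_le_castSucc _ _ (by rw [Fin.le_def]; simp; omega)]
    have : i ≠ p := by intro hprime; subst hprime; omega
    have h3 : ¬ (i : ℕ) < d := by omega
    have h4 : (i : ℕ) ≠ d := by omega
    simp [h3, h4, this]
    ring

lemma sec_succ (k j : ℕ) (h1 : 1 ≤ j) (h2 : j ≤ k + 1) (u : ℝ) (p : Fin (k + 1))
    (hp : (p : ℕ) = k + 1 - j) (i : Fin (k + 1)) :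
    x0 (k + 2) (p.succ.succAbove i) = sectionVec (k + 2) j u i +
      if i = p then (k + 1) * u - j + 1 else 0 := by
  obtain ⟨d, hd⟩ : ∃ d, k + 1 = j + d := ⟨_, (Nat.add_sub_cancel' h2).symm⟩
  have hpd : (p : ℕ) = d := by omega
  have hk : (k : ℝ) + 1 = j + d := by exact_mod_cast hd
  have e : k + 2 - 1 - j = d := by omega
  simp only [x0, sectionVec, e]
  rcases lt_trichotomy (i : ℕ) d with h | h | h
  · rw [Fin.succAbove_of_castSucc_lt _ _ (by rw [Fin.lt_def]; simp; omega)]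
    have : i ≠ p := by intro hprime; subst hprime; omega
    simp [h, this]
  · have : i = p := Fin.ext (by omega)
    rw [Fin.succAbove_of_castSucc_lt _ _ (by rw [Fin.lt_def]; simp; omega)]
    simp [h, this, hpd]
    linarith
  · rw [Fin.succAbove_of_le_castSucc _ _ (by rw [Fin.le_def]; simp; omega)]
    have : i ≠ p := by intro hprime; subst hprime; omega
    have h3 : ¬ (i : ℕ) < d := by omega
    have h4 : (i : ℕ) ≠ d := by omega
    simp [h3, h4, this]
    ring

/-- The permutation of `Fin (m+1)` sending `0` to `q` and `i+1` to `q.succAbove (τ i)`. -/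
def extPerm {m : ℕ} (q : Fin (m + 1)) (τ : Equiv.Perm (Fin m)) : Equiv.Perm (Fin (m + 1)) :=
  ((finSuccEquiv' 0).trans (Equiv.optionCongr τ)).trans (finSuccEquiv' q).symm

lemma extPerm_zero {m : ℕ} (q : Fin (m + 1)) (τ : Equiv.Perm (Fin m)) :
    extPerm q τ 0 = q := by simp [extPerm]

lemma extPerm_succ {m : ℕ} (q : Fin (m + 1)) (τ : Equiv.Perm (Fin m)) (i : Fin m) :
    extPerm q τ i.succ = q.succAbove (τ i) := by
  have : finSuccEquiv' (0 : Fin (m+1)) i.succ = some i := by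
    rw [← Fin.succAbove_zero_apply, finSuccEquiv'_succAbove]
  simp [extPerm, this]

lemma section_iff (k j : ℕ) (h1 : 1 ≤ j) (h2 : j ≤ k + 1) (u : ℝ)
    (hu1 : (j : ℝ) - 1 ≤ (k + 1) * u) (hu2 : (k + 1) * u ≤ j) (v : Fin (k + 1) → ℝ) :
    (Fin.cons ((k + 1) * u) v : Fin (k + 2) → ℝ) ∈ permutohedron (k + 2) (x0 (k + 2)) ↔
      v ∈ permutohedron (k + 1) (sectionVec (k + 2) j u) := by
  set p : Fin (k + 1) := ⟨k + 1 - j, by omega⟩ with hp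
  have hpv : (p : ℕ) = k + 1 - j := rfl
  have hS := sec_castSucc k j h1 h2 u p hpv
  have hT := sec_succ k j h1 h2 u p hpv
  have hpr : ((p : ℕ) : ℝ) = k + 1 - j := by
    rw [hpv, Nat.cast_sub h2]; push_cast; ring
  have hxc : x0 (k + 2) p.castSucc = j := by
    simp only [x0, Fin.val_castSucc, hpr]; push_cast; ring
  have hxs : x0 (k + 2) p.succ = j - 1 := by
    simp only [x0, Fin.val_succ, Nat.cast_add, hpr]; push_cast; ring
  constructor
  · intro h
    rw [mem_iff] at h
    apply mem_of_antitone
    intro c hc τ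
    obtain ⟨σ, hσ⟩ := h (Fin.cons (c p) (fun i => c (τ⁻¹ i)))
    set d : Fin (k + 2) → ℝ := fun i => c (p.predAbove i) with hd
    have hda : Antitone d := hc.comp_monotone (Fin.predAbove_right_monotone p)
    set ρ := extPerm p.castSucc τ⁻¹ with hρ
    have hC : ∀ i, (Fin.cons (c p) (fun i => c (τ⁻¹ i)) : Fin (k + 2) → ℝ) i = d (ρ i) := by
      intro i
      refine Fin.cases ?_ (fun i => ?_) i
      · rw [hρ, extPerm_zero]; simp [hd]
      · rw [hρ, extPerm_succ]; simp only [Fin.cons_succ, hd, Fin.predAbove_succAbove]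
    have hre : ∑ i, (Fin.cons (c p) (fun i => c (τ⁻¹ i)) : Fin (k + 2) → ℝ) i *
        x0 (k + 2) (σ i) ≤ ∑ i, d i * x0 (k + 2) i := by
      have hmv : Monovary d (x0 (k + 2)) := hda.monovary (x0_antitone _)
      have := hmv.sum_mul_comp_perm_le_sum_mul (σ := ρ⁻¹.trans σ)
      refine le_trans (le_of_eq ?_) this
      rw [← Equiv.sum_comp ρ (fun i => d i * x0 (k+2) ((ρ⁻¹.trans σ) i))]
      refine Finset.sum_congr rfl fun i _ => ?_
      rw [hC]; simp
    have hsum : ∑ i, d i * x0 (k + 2) i =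
        ∑ i, c i * sectionVec (k + 2) j u i + c p * ((k + 1) * u) := by
      rw [Fin.sum_univ_succAbove _ p.castSucc]
      simp only [hS, hd, Fin.predAbove_succAbove, Fin.predAbove_castSucc_self, hxc, mul_add,
        Finset.sum_add_distrib]
      simp
      ring
    rw [hsum] at hre
    have h3 := hσ.trans hre
    rw [Fin.sum_univ_succ] at h3
    simp only [Fin.cons_zero, Fin.cons_succ] at h3
    rw [← Equiv.sum_comp τ] at h3
    simp only [Equiv.Perm.inv_def, Equiv.symm_apply_apply] at h3
    linarith
  · intro h
    rw [mem_iff] at h ⊢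
    intro c
    obtain ⟨σ, hσ⟩ := h (fun i => c i.succ)
    set q := σ⁻¹ p with hq
    have hiff : ∀ i, σ i = p ↔ i = q := by
      intro i; rw [hq, Equiv.Perm.eq_inv_iff_eq]
    rcases le_total (c q.succ) (c 0) with hc | hc
    · refine ⟨extPerm p.castSucc σ, ?_⟩
      rw [Fin.sum_univ_succ (n := k + 1), Fin.sum_univ_succ (n := k + 1)]
      simp only [extPerm_zero, extPerm_succ, hS, hxc, Fin.cons_zero, Fin.cons_succ, mul_add,
        Finset.sum_add_distrib, hiff]
      simp only [mul_ite, mul_zero, Finset.sum_ite_eq', Finset.mem_univ, if_true]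
      nlinarith
    · refine ⟨extPerm p.succ σ, ?_⟩
      rw [Fin.sum_univ_succ (n := k + 1), Fin.sum_univ_succ (n := k + 1)]
      simp only [extPerm_zero, extPerm_succ, hT, hxs, Fin.cons_zero, Fin.cons_succ, mul_add,
        Finset.sum_add_distrib, hiff]
      simp only [mul_ite, mul_zero, Finset.sum_ite_eq', Finset.mem_univ, if_true]
      nlinarith


lemma sum_lt_one (n k : ℕ) (hk : k ≤ n) :
    ∑ i : Fin n, (if (i : ℕ) < k then (1 : ℝ) else 0) = k := by
  rw [← Finset.sum_range (fun i => if i < k then (1 : ℝ) else 0), ← Finset.sum_filter]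
  have : (Finset.range n).filter (fun i => i < k) = Finset.range k := by
    ext i; simp; omega
  simp [this]

lemma sum_lt_id (n k : ℕ) (hk : k ≤ n) :
    ∑ i : Fin n, (if (i : ℕ) < k then ((i : ℕ) : ℝ) else 0) = k * (k - 1) / 2 := by
  rw [← Finset.sum_range (fun i => if i < k then (i : ℝ) else 0), ← Finset.sum_filter]
  have : (Finset.range n).filter (fun i => i < k) = Finset.range k := by
    ext i; simp; omega
  rw [this]
  clear this hk
  induction k with
  | zero => simp
  | succ k ih => rw [Finset.sum_range_succ, ih]; push_cast; ring

lemma abel (n : ℕ) : ∀ (c g : Fin (n + 1) → ℝ), Antitone c →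
    (∀ k : ℕ, k ≤ n → ∑ i : Fin (n + 1), (if (i : ℕ) < k then g i else 0) ≤ 0) →
    ∑ i, c i * g i ≤ c (Fin.last n) * ∑ i, g i := by
  induction n with
  | zero => intro c g _ _; simp
  | succ n ih =>
    intro c g hc hg
    have hlt : ∀ i : Fin (n + 1), (i : ℕ) < n + 1 := fun i => i.isLt
    have h1 := ih (fun i => c i.castSucc) (fun i => g i.castSucc)
      (hc.comp_monotone (Fin.strictMono_castSucc.monotone)) (by
        intro k hk
        have := hg k (by omega)
        rw [Fin.sum_univ_castSucc] at this
        simpa [show ¬ (n + 1 < k) by omega] using this)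
    have h2 := hg (n + 1) le_rfl
    rw [Fin.sum_univ_castSucc] at h2
    simp only [Fin.val_castSucc, Fin.val_last, lt_irrefl, if_false, add_zero, hlt, if_true] at h2
    rw [Fin.sum_univ_castSucc, Fin.sum_univ_castSucc (f := g)]
    have h3 : c (Fin.last (n + 1)) ≤ c (Fin.last n).castSucc := hc (Fin.le_last _)
    nlinarith

/-- sign comparing two indices -/
def sg {n : ℕ} (i j : Fin n) : ℝ := if i < j then 1 else if j < i then -1 else 0

lemma sum_sg (m : ℕ) (i : Fin (m + 1)) : ∑ j, sg i j = (m : ℝ) - 2 * (i : ℕ) := by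
  have h : ∀ j : Fin (m + 1), sg i j = 1 - (if (j : ℕ) < (i : ℕ) + 1 then (1 : ℝ) else 0)
      - (if (j : ℕ) < i then (1 : ℝ) else 0) := by
    intro j
    simp only [sg, Fin.lt_def]
    rcases lt_trichotomy (i : ℕ) j with h | h | h
    · simp [h, show ¬ (j : ℕ) < i + 1 by omega, show ¬ (j : ℕ) < i by omega]
    · simp [h]
    · simp [h, show ¬ (i : ℕ) < j by omega, show (j : ℕ) < i + 1 by omega]
  simp only [h, Finset.sum_sub_distrib]
  rw [sum_lt_one _ _ (by omega), sum_lt_one _ _ (by omega)]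
  simp; ring

lemma key_int (m : ℕ) (b : Fin (m + 1) → ℤ) :
    ∑ i : Fin (m + 1), ((m : ℝ) - 2 * (i : ℕ)) * b i ≤ (m + 1) * ∑ i, (b i : ℝ) ^ 2 - (∑ i, (b i : ℝ)) ^ 2 := by
  have h1 : ∑ i, ∑ j, sg i j * ((b i : ℝ) - b j) = 2 * ∑ i : Fin (m + 1), ((m : ℝ) - 2 * (i : ℕ)) * b i := by
    have e1 : ∑ i, ∑ j, sg i j * (b i : ℝ) = ∑ i : Fin (m + 1), ((m : ℝ) - 2 * (i : ℕ)) * b i := by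
      refine Finset.sum_congr rfl fun i _ => ?_
      rw [← Finset.sum_mul, sum_sg]
    have e2 : ∑ i, ∑ j, sg i j * (b j : ℝ) = - ∑ i : Fin (m + 1), ((m : ℝ) - 2 * (i : ℕ)) * b i := by
      rw [Finset.sum_comm, ← e1, ← Finset.sum_neg_distrib]
      refine Finset.sum_congr rfl fun i _ => ?_
      rw [← Finset.sum_neg_distrib]
      refine Finset.sum_congr rfl fun j _ => ?_
      have : sg j i = - sg i j := by
        simp only [sg]
        rcases lt_trichotomy i j with h | h | h
        · simp [h, h.not_gt]
        · simp [h]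
        · simp [h, h.not_gt]
      rw [this]; ring
    simp only [mul_sub, Finset.sum_sub_distrib, e1, e2]
    ring
  have h2 : ∑ i, ∑ j, ((b i : ℝ) - b j) ^ 2 =
      2 * ((m + 1) * ∑ i, (b i : ℝ) ^ 2 - (∑ i, (b i : ℝ)) ^ 2) := by
    simp only [sub_sq, Finset.sum_add_distrib, Finset.sum_sub_distrib, ← Finset.mul_sum,
      ← Finset.sum_mul, mul_assoc, Finset.sum_const, Finset.card_univ, Fintype.card_fin,
      nsmul_eq_mul]
    push_cast
    ring
  have h3 : ∑ i, ∑ j, sg i j * ((b i : ℝ) - b j) ≤ ∑ i, ∑ j, ((b i : ℝ) - b j) ^ 2 := by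
    refine Finset.sum_le_sum fun i _ => Finset.sum_le_sum fun j _ => ?_
    have hz : ∀ z : ℤ, (z : ℝ) ≤ z ^ 2 := fun z => by exact_mod_cast Int.le_self_sq z
    have hd := hz (b i - b j)
    have hd' := hz (-(b i - b j))
    push_cast at hd hd'
    simp only [sg]
    split_ifs
    · linarith
    · linarith
    · nlinarith [sq_nonneg ((b i : ℝ) - b j)]
  linarith

lemma sum_x0 (m : ℕ) : ∑ i, x0 (m + 1) i = (m + 1) * m / 2 := by
  have h := sum_lt_id (m + 1) (m + 1) le_rfl
  have hprime : ∑ i : Fin (m + 1), ((i : ℕ) : ℝ) = (m + 1) * m / 2 := by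
    rw [← Nat.cast_succ, show (m : ℝ) = ((m + 1 : ℕ) : ℝ) - 1 by push_cast; ring, ← h]
    exact Finset.sum_congr rfl fun i _ => by rw [if_pos i.isLt]
  simp only [x0, Finset.sum_sub_distrib, hprime]
  simp; ring

lemma sum_of_mem (m : ℕ) (y : Fin (m + 1) → ℝ) (h : y ∈ permutohedron (m + 1) (x0 (m + 1))) :
    ∑ i, y i = (m + 1) * m / 2 := by
  rw [mem_iff] at h
  obtain ⟨σ, h1⟩ := h (fun _ => 1)
  obtain ⟨τ, h2⟩ := h (fun _ => -1)
  simp only [one_mul, neg_mul, Finset.sum_neg_distrib] at h1 h2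
  rw [Equiv.sum_comp σ (x0 (m + 1)), sum_x0] at h1
  rw [Equiv.sum_comp τ (x0 (m + 1)), sum_x0] at h2
  linarith

lemma mem_iff_good (m : ℕ) (y : Fin (m + 1) → ℝ) : y ∈ permutohedron (m + 1) (x0 (m + 1)) ↔
    ∑ i, y i = (m + 1) * m / 2 ∧ ∀ b : Fin (m + 1) → ℤ, ∑ i, (2 * y i - m) * b i ≤
      (m + 1) * ∑ i, (b i : ℝ) ^ 2 - (∑ i, (b i : ℝ)) ^ 2 := by
  constructor
  · intro h
    refine ⟨sum_of_mem m y h, fun b => ?_⟩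
    rw [mem_iff] at h
    obtain ⟨σ, hσ⟩ := h (fun i => b i)
    have hk := key_int m (fun i => b (σ⁻¹ i))
    rw [← Equiv.sum_comp σ, ← Equiv.sum_comp σ (fun i => ((b (σ⁻¹ i) : ℤ) : ℝ) ^ 2),
      ← Equiv.sum_comp σ (fun i => ((b (σ⁻¹ i) : ℤ) : ℝ))] at hk
    simp only [Equiv.Perm.inv_def, Equiv.symm_apply_apply] at hk
    refine le_trans ?_ hk
    have e1 : ∑ i, (2 * y i - m) * (b i : ℝ) = 2 * ∑ i, (b i : ℝ) * y i - m * ∑ i, (b i : ℝ) := by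
      rw [Finset.mul_sum, Finset.mul_sum, ← Finset.sum_sub_distrib]
      exact Finset.sum_congr rfl fun i _ => by ring
    have e2 : ∑ i, ((m : ℝ) - 2 * (σ i : ℕ)) * (b i : ℝ) =
        2 * ∑ i, (b i : ℝ) * x0 (m + 1) (σ i) - m * ∑ i, (b i : ℝ) := by
      rw [Finset.mul_sum, Finset.mul_sum, ← Finset.sum_sub_distrib]
      exact Finset.sum_congr rfl fun i _ => by simp only [x0]; push_cast; ring
    rw [e1, e2]
    linarith
  · rintro ⟨hs, hb⟩
    apply mem_of_antitone
    intro c hc τ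
    have := abel m c (fun i => y (τ i) - x0 (m + 1) i) hc (by
      intro k hk
      have hb' := hb (fun i => if ((τ⁻¹ i : Fin (m + 1)) : ℕ) < k then 1 else 0)
      rw [← Equiv.sum_comp τ,
        ← Equiv.sum_comp τ (fun i => (((if ((τ⁻¹ i : Fin (m + 1)) : ℕ) < k then 1 else 0 : ℤ)) : ℝ) ^ 2),
        ← Equiv.sum_comp τ (fun i => (((if ((τ⁻¹ i : Fin (m + 1)) : ℕ) < k then 1 else 0 : ℤ)) : ℝ))]
        at hb'
      simp only [Equiv.Perm.inv_def, Equiv.symm_apply_apply, Int.cast_ite, Int.cast_one,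
        Int.cast_zero, ite_pow, one_pow, ne_eq, OfNat.ofNat_ne_zero, not_false_eq_true,
        zero_pow] at hb'
      have hc1 := sum_lt_one (m + 1) k (by omega)
      have hc2 := sum_lt_id (m + 1) k (by omega)
      rw [hc1] at hb'
      have e1 : ∑ i, (2 * y (τ i) - m) * (if (i : ℕ) < k then (1 : ℝ) else 0) =
          2 * ∑ i : Fin (m + 1), (if (i : ℕ) < k then y (τ i) - x0 (m + 1) i else 0)
          + m * ∑ i : Fin (m + 1), (if (i : ℕ) < k then (1 : ℝ) else 0)
          - 2 * ∑ i : Fin (m + 1), (if (i : ℕ) < k then ((i : ℕ) : ℝ) else 0) := by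
        rw [Finset.mul_sum, Finset.mul_sum, Finset.mul_sum, ← Finset.sum_add_distrib,
          ← Finset.sum_sub_distrib]
        refine Finset.sum_congr rfl fun i _ => ?_
        split_ifs
        · simp only [x0]; push_cast; ring
        · ring
      rw [e1, hc1, hc2] at hb'
      nlinarith)
    rw [Finset.sum_sub_distrib, Equiv.sum_comp τ y, hs, sum_x0] at this
    simp only [mul_sub, Finset.sum_sub_distrib] at this
    linarith

/-- the quadratic form -/
def q {m : ℕ} (x : Fin m → ℝ) : ℝ := (m + 1) * ∑ i, x i ^ 2 - (∑ i, x i) ^ 2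

/-- Voronoi cell of `ℤ^m` for the form `q`. -/
def V (m : ℕ) : Set (Fin m → ℝ) := {x | ∀ a : Fin m → ℤ, q x ≤ q (fun i => x i - a i)}

lemma q_sub {m : ℕ} (x a : Fin m → ℝ) : q (fun i => x i - a i) =
    q x - 2 * ((m + 1) * ∑ i, x i * a i - (∑ i, x i) * ∑ i, a i) + q a := by
  simp only [q, sub_sq, Finset.sum_add_distrib, Finset.sum_sub_distrib, mul_assoc,
    ← Finset.mul_sum]
  ring

/-- complete a vector of `ℝ^m` to one with the right coordinate sum -/
noncomputable def compl {m : ℕ} (y : Fin m → ℝ) : Fin (m + 1) → ℝ :=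
  Fin.snoc y ((m + 1) * m / 2 - ∑ i, y i)

/-- the projected permutohedron -/
def Q (m : ℕ) : Set (Fin m → ℝ) := {y | compl y ∈ permutohedron (m + 1) (x0 (m + 1))}

/-- the affine map -/
noncomputable def aff {m : ℕ} (x : Fin m → ℝ) : Fin m → ℝ :=
  fun i => (m : ℝ) / 2 + ((m + 1) * x i - ∑ i, x i)

lemma sum_compl {m : ℕ} (y : Fin m → ℝ) : ∑ i, compl y i = (m + 1) * m / 2 := by
  rw [Fin.sum_univ_castSucc]; simp [compl]

lemma V_iff (m : ℕ) (x : Fin m → ℝ) : aff x ∈ Q m ↔ x ∈ V m := by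
  have hlast : compl (aff x) (Fin.last m) = m / 2 - ∑ i, x i := by
    simp only [compl, Fin.snoc_last, aff, Finset.sum_add_distrib, Finset.sum_sub_distrib,
      ← Finset.mul_sum]
    simp; ring
  have hcs : ∀ i : Fin m, compl (aff x) i.castSucc = m / 2 + ((m + 1) * x i - ∑ i, x i) := by
    intro i; simp [compl, aff]
  have main : ∀ b : Fin (m + 1) → ℤ,
      (∑ i, (2 * compl (aff x) i - m) * b i ≤
        (m + 1) * ∑ i, (b i : ℝ) ^ 2 - (∑ i, (b i : ℝ)) ^ 2) ↔
      q x ≤ q (fun i => x i - ((b i.castSucc - b (Fin.last m) : ℤ) : ℝ)) := by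
    intro b
    obtain ⟨a, ha⟩ : ∃ a : Fin m → ℤ, ∀ i, b i.castSucc = a i + b (Fin.last m) :=
      ⟨fun i => b i.castSucc - b (Fin.last m), fun i => by ring⟩
    rw [q_sub x (fun i => ((b i.castSucc - b (Fin.last m) : ℤ) : ℝ))]
    simp only [Fin.sum_univ_castSucc (n := m), hlast, hcs, ha, q, add_sub_cancel_right]
    set β := b (Fin.last m)
    have e1 : ∑ i, (2 * ((m : ℝ) / 2 + ((m + 1) * x i - ∑ i, x i)) - m) * ((a i + β : ℤ) : ℝ) =
        2 * (m + 1) * ∑ i, x i * (a i : ℝ) - 2 * (∑ i, x i) * ∑ i, (a i : ℝ)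
          + β * (2 * (m + 1) * ∑ i, x i - 2 * m * ∑ i, x i) := by
      have : ∀ i, (2 * ((m : ℝ) / 2 + ((m + 1) * x i - ∑ i, x i)) - m) * ((a i + β : ℤ) : ℝ) =
        2 * (m + 1) * (x i * (a i : ℝ)) - 2 * (∑ i, x i) * (a i : ℝ)
          + β * (2 * (m + 1) * x i) - β * (2 * ∑ i, x i) := by intro i; push_cast; ring
      simp only [this, Finset.sum_add_distrib, Finset.sum_sub_distrib, ← Finset.mul_sum]
      simp; ring
    have e2 : ∑ i, ((a i + β : ℤ) : ℝ) ^ 2 =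
        ∑ i, (a i : ℝ) ^ 2 + 2 * β * ∑ i, (a i : ℝ) + m * β ^ 2 := by
      have : ∀ i, ((a i + β : ℤ) : ℝ) ^ 2 = (a i : ℝ) ^ 2 + 2 * β * (a i : ℝ) + β ^ 2 := by
        intro i; push_cast; ring
      simp only [this, Finset.sum_add_distrib, ← Finset.mul_sum]
      simp
    have e3 : ∑ i, ((a i + β : ℤ) : ℝ) = ∑ i, (a i : ℝ) + m * β := by
      push_cast
      simp only [Finset.sum_add_distrib]
      simp
    rw [e1, e2, e3]
    constructor <;> intro h <;> nlinarith
  simp only [Q, V, Set.mem_ofPred_eq]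
  rw [mem_iff_good]
  constructor
  · rintro ⟨-, h⟩ a
    have := (main (Fin.snoc a 0)).1 (h _)
    simpa using this
  · intro h
    refine ⟨sum_compl _, fun b => (main b).2 ?_⟩
    exact h (fun i => b i.castSucc - b (Fin.last m))


lemma q_ge {m : ℕ} (x : Fin m → ℝ) : ∑ i, x i ^ 2 ≤ q x := by
  have := sq_sum_le_card_mul_sum_sq (s := Finset.univ) (f := x)
  simp only [Finset.card_univ, Fintype.card_fin] at this
  simp only [q]
  linarith

lemma q_continuous {m : ℕ} : Continuous (q : (Fin m → ℝ) → ℝ) := by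
  unfold q; fun_prop

lemma V_closed (m : ℕ) : IsClosed (V m) := by
  have : V m = ⋂ a : Fin m → ℤ, {x | q x ≤ q (fun i => x i - a i)} := by
    ext x; simp [V]
  rw [this]
  refine isClosed_iInter fun a => isClosed_le q_continuous ?_
  exact q_continuous.comp (by fun_prop)

lemma exists_min {m : ℕ} (x : Fin m → ℝ) : ∃ a : Fin m → ℤ, ∀ b : Fin m → ℤ,
    q (fun i => x i - a i) ≤ q (fun i => x i - b i) := by
  set C := q x with hC
  have hfin : {a : Fin m → ℤ | q (fun i => x i - a i) ≤ C}.Finite := by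
    refine (Set.finite_Icc (fun i => ⌊x i - (C + 1)⌋) (fun i => ⌈x i + (C + 1)⌉)).subset ?_
    intro a ha
    have hi : ∀ i, (x i - a i) ^ 2 ≤ C := by
      intro i
      refine le_trans ?_ ((q_ge _).trans ha)
      exact Finset.single_le_sum (f := fun i => (x i - (a i : ℝ)) ^ 2)
        (fun i _ => sq_nonneg _) (Finset.mem_univ i)
    constructor
    · intro i
      have : (⌊x i - (C + 1)⌋ : ℝ) ≤ a i := by
        refine (Int.floor_le _).trans ?_
        nlinarith [hi i, sq_nonneg (x i - a i - 1)]
      exact_mod_cast this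
    · intro i
      have : (a i : ℝ) ≤ ⌈x i + (C + 1)⌉ := by
        refine le_trans ?_ (Int.le_ceil _)
        nlinarith [hi i, sq_nonneg (x i - a i + 1)]
      exact_mod_cast this
  have h0 : (0 : Fin m → ℤ) ∈ {a : Fin m → ℤ | q (fun i => x i - a i) ≤ C} := by
    simp [hC]
  obtain ⟨a, ha, hmin⟩ := Set.exists_min_image _ (fun a : Fin m → ℤ => q (fun i => x i - a i))
    hfin ⟨0, h0⟩
  refine ⟨a, fun b => ?_⟩
  by_cases hb : q (fun i => x i - b i) ≤ C
  · exact hmin b hb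
  · exact le_trans ha (not_le.1 hb).le

lemma null_level {m : ℕ} (ℓ : (Fin m → ℝ) →ₗ[ℝ] ℝ) (v : Fin m → ℝ) (hv : ℓ v ≠ 0) (r : ℝ) :
    volume {x | ℓ x = r} = 0 := by
  set S : AffineSubspace ℝ (Fin m → ℝ) := (AffineSubspace.mk' r ⊥).comap ℓ.toAffineMap with hS
  have hmem : ∀ x, x ∈ S ↔ ℓ x = r := by
    intro x
    simp [hS, AffineSubspace.mem_comap, AffineSubspace.mem_mk', sub_eq_zero]
  have hne : S ≠ ⊤ := by
    intro h
    have h1 : (0 : Fin m → ℝ) ∈ S := by rw [h]; trivial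
    have h2 : v ∈ S := by rw [h]; trivial
    rw [hmem] at h1 h2
    rw [map_zero] at h1
    exact hv (h2.trans h1.symm)
  have := Measure.addHaar_affineSubspace (volume : Measure (Fin m → ℝ)) S hne
  convert this using 2
  ext x; exact (hmem x).symm

/-- The bilinear form as a linear functional. -/
noncomputable def Bl {m : ℕ} (a : Fin m → ℝ) : (Fin m → ℝ) →ₗ[ℝ] ℝ where
  toFun x := (m + 1) * ∑ i, x i * a i - (∑ i, x i) * ∑ i, a i
  map_add' x y := by
    simp only [Pi.add_apply, add_mul, Finset.sum_add_distrib]; ring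
  map_smul' c x := by
    simp only [Pi.smul_apply, smul_eq_mul, mul_assoc, ← Finset.mul_sum, RingHom.id_apply]; ring

lemma mem_L {m : ℕ} (x : Fin m → ℝ) :
    x ∈ Submodule.span ℤ (Set.range (Pi.basisFun ℝ (Fin m))) ↔
      ∃ a : Fin m → ℤ, ∀ i, x i = a i := by
  rw [Module.Basis.mem_span_iff_repr_mem]
  simp only [Pi.basisFun_repr, Set.mem_range]
  constructor
  · intro h
    choose a ha using h
    exact ⟨a, fun i => by rw [← ha]; simp⟩
  · rintro ⟨a, ha⟩ i
    exact ⟨a i, by rw [ha]; simp⟩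

lemma fund (m : ℕ) : IsAddFundamentalDomain
    (Submodule.span ℤ (Set.range (Pi.basisFun ℝ (Fin m)))) (V m) volume where
  nullMeasurableSet := (V_closed m).measurableSet.nullMeasurableSet
  ae_covers := by
    refine Filter.Eventually.of_forall fun x => ?_
    obtain ⟨a, ha⟩ := exists_min x
    refine ⟨⟨fun i => ((- a i : ℤ) : ℝ), (mem_L _).2 ⟨fun i => - a i, fun i => rfl⟩⟩, ?_⟩
    intro b
    have := ha (fun i => a i + b i)
    rw [Submodule.vadd_def]
    convert this using 2
    · ext i; simp; ring
    · ext i; simp; ring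
  aedisjoint := by
    rintro ⟨g, hg⟩ ⟨h, hh⟩ hne
    obtain ⟨a, ha⟩ := (mem_L g).1 hg
    obtain ⟨b, hb⟩ := (mem_L h).1 hh
    have hq : Bl (fun i => h i - g i) (fun i => h i - g i) ≠ 0 := by
      have h1 : Bl (fun i => h i - g i) (fun i => h i - g i) = q (fun i => h i - g i) := by
        simp only [Bl, LinearMap.coe_mk, AddHom.coe_mk, q]
        ring_nf
      rw [h1]
      intro h0
      have h2 := q_ge (fun i => h i - g i)
      rw [h0] at h2
      have h3 := (Finset.sum_eq_zero_iff_of_nonneg (fun i _ => sq_nonneg (h i - g i))).1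
        (le_antisymm h2 (Finset.sum_nonneg fun i _ => sq_nonneg _))
      apply hne
      have : g = h := by
        ext i
        have := h3 i (Finset.mem_univ i)
        have := pow_eq_zero_iff (two_ne_zero) |>.1 this
        linarith
      simp [this]
    refine measure_mono_null ?_ (null_level (Bl (fun i => h i - g i)) _ hq ((q h - q g) / 2))
    rintro x ⟨hx1, hx2⟩
    simp only [Set.mem_vadd_set] at hx1 hx2
    obtain ⟨y, hy, rfl⟩ := hx1
    obtain ⟨z, hz, hzy⟩ := hx2
    simp only [Submodule.vadd_def, vadd_eq_add] at hzy ⊢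
    have e1 := hy (fun i => b i - a i)
    have e2 := hz (fun i => a i - b i)
    have hyi : y = fun i => (g + y) i - g i := by ext i; simp
    have hzi : z = fun i => (g + y) i - h i := by ext i; rw [← hzy]; simp
    have e3 : (fun i => y i - ((b i - a i : ℤ) : ℝ)) = z := by
      rw [hzi]; ext i; simp [ha, hb]; ring
    have e4 : (fun i => z i - ((a i - b i : ℤ) : ℝ)) = y := by
      rw [hzi]; ext i; simp [ha, hb]
    rw [e3] at e1
    rw [e4] at e2
    have e5 : q y = q z := le_antisymm e1 e2
    rw [hyi, hzi, q_sub, q_sub] at e5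
    simp only [Set.mem_ofPred_eq, Bl, LinearMap.coe_mk, AddHom.coe_mk, mul_sub,
      Finset.sum_sub_distrib]
    linarith

lemma volume_V (m : ℕ) : volume (V m) = 1 := by
  have h := (ZSpan.isAddFundamentalDomain (Pi.basisFun ℝ (Fin m)) volume)
  haveI : VAddInvariantMeasure (Submodule.span ℤ (Set.range (Pi.basisFun ℝ (Fin m))))
    (Fin m → ℝ) volume := inferInstanceAs <| VAddInvariantMeasure
      (Submodule.span ℤ (Set.range (Pi.basisFun ℝ (Fin m)))).toAddSubgroup (Fin m → ℝ) volume
  rw [(fund m).measure_eq h, ZSpan.fundamentalDomain_pi_basisFun, volume_pi, Measure.pi_pi]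
  simp

/-- The matrix `n I - J`. -/
noncomputable def TM (m : ℕ) : Matrix (Fin m) (Fin m) ℝ :=
  ((m : ℝ) + 1) • (1 + Matrix.replicateCol Unit (fun _ => - ((m : ℝ) + 1)⁻¹) *
    Matrix.replicateRow Unit (fun _ => (1 : ℝ)))

lemma det_TM (k : ℕ) : (TM (k + 1)).det = ((k : ℝ) + 2) ^ k := by
  have : (k : ℝ) + 2 ≠ 0 := by positivity
  rw [TM, Matrix.det_smul, Matrix.det_one_add_replicateCol_mul_replicateRow]
  simp only [dotProduct, Fintype.card_fin, Finset.sum_const, Finset.card_univ, nsmul_eq_mul]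
  push_cast
  rw [show (k : ℝ) + 1 + 1 = k + 2 by ring]
  rw [pow_succ]
  field_simp
  ring

lemma TM_apply (m : ℕ) (x : Fin m → ℝ) (i : Fin m) :
    Matrix.toLin' (TM m) x i = (m + 1) * x i - ∑ i, x i := by
  have : (m : ℝ) + 1 ≠ 0 := by positivity
  rw [Matrix.toLin'_apply, TM, Matrix.smul_mulVec, Matrix.add_mulVec, Matrix.one_mulVec]
  simp only [Pi.smul_apply, Pi.add_apply, smul_eq_mul, Matrix.mulVec, dotProduct, Matrix.mul_apply,
    Matrix.replicateCol_apply, Matrix.replicateRow_apply, Finset.univ_unique, Finset.sum_singleton,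
    mul_one, ← Finset.mul_sum]
  field_simp
  ring

lemma volume_Q (k : ℕ) : volume (Q (k + 1)) = ENNReal.ofReal (((k : ℝ) + 2) ^ k) := by
  have hdet : LinearMap.det (Matrix.toLin' (TM (k + 1))) = ((k : ℝ) + 2) ^ k := by
    rw [LinearMap.det_toLin', det_TM]
  have hpos : 0 < ((k : ℝ) + 2) ^ k := by positivity
  have h := Measure.addHaar_preimage_linearMap (volume : Measure (Fin (k + 1) → ℝ))
    (f := Matrix.toLin' (TM (k + 1))) (by rw [hdet]; exact hpos.ne')
    ((fun y => (fun _ => ((k + 1 : ℕ) : ℝ) / 2) + y) ⁻¹' (Q (k + 1)))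
  have e : (Matrix.toLin' (TM (k + 1))) ⁻¹'
      ((fun y => (fun _ => ((k + 1 : ℕ) : ℝ) / 2) + y) ⁻¹' (Q (k + 1))) = V (k + 1) := by
    ext x
    rw [← V_iff, Set.mem_preimage, Set.mem_preimage]
    have : aff x = (fun _ => ((k + 1 : ℕ) : ℝ) / 2) + Matrix.toLin' (TM (k + 1)) x := by
      ext i; simp only [Pi.add_apply, TM_apply, aff]
    rw [this]
  rw [e, volume_V, measure_preimage_add, hdet, abs_of_pos (by positivity)] at h
  rw [ENNReal.ofReal_inv_of_pos hpos] at h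
  have hne : ENNReal.ofReal (((k : ℝ) + 2) ^ k) ≠ 0 := by simpa using hpos
  calc volume (Q (k + 1)) = ENNReal.ofReal (((k : ℝ) + 2) ^ k) *
      ((ENNReal.ofReal (((k : ℝ) + 2) ^ k))⁻¹ * volume (Q (k + 1))) := by
        rw [← mul_assoc, ENNReal.mul_inv_cancel hne ENNReal.ofReal_ne_top, one_mul]
    _ = _ := by rw [← h, mul_one]


lemma hausdorff_linear {d : ℕ} {F : Type*} [NormedAddCommGroup F] [NormedSpace ℝ F]
    [MeasurableSpace F] [BorelSpace F]
    (L : (Fin d → ℝ) →ₗ[ℝ] F) (hL : Function.Injective L) (v : F) :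
    ∃ c : ENNReal, c ≠ 0 ∧ c ≠ ⊤ ∧ ∀ A : Set (Fin d → ℝ), MeasurableSet A →
      μH[(d : ℝ)] ((fun y => v + L y) '' A) = c * volume A := by
  obtain ⟨K, hK, hanti⟩ := L.exists_antilipschitzWith (LinearMap.ker_eq_bot.2 hL)
  have hlip : LipschitzWith ‖L.toContinuousLinearMap‖₊ L := L.toContinuousLinearMap.lipschitz
  have hemb : MeasurableEmbedding L :=
    (hanti.isClosedEmbedding hlip.uniformContinuous).measurableEmbedding
  have hvol : (μH[(d : ℝ)] : Measure (Fin d → ℝ)) = volume := by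
    have := hausdorffMeasure_pi_real (ι := Fin d)
    simpa using this
  set ν : Measure (Fin d → ℝ) := (μH[(d : ℝ)] : Measure F).comap L with hν
  have hνA : ∀ A, ν A = μH[(d : ℝ)] (L '' A) := fun A => hemb.comap_apply _ _
  haveI : IsFiniteMeasureOnCompacts ν := ⟨by
    intro C hC
    rw [hνA]
    refine lt_of_le_of_lt (hlip.hausdorffMeasure_image_le (by positivity) C) ?_
    rw [hvol]
    exact ENNReal.mul_lt_top (ENNReal.rpow_lt_top_of_nonneg (by positivity) ENNReal.coe_ne_top)
      hC.measure_lt_top⟩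
  haveI : ν.IsAddLeftInvariant := ⟨by
    intro g
    ext A hA
    rw [Measure.map_apply (measurable_const_add g) hA, hνA, hνA]
    have : L '' ((fun x => g + x) ⁻¹' A) = (fun z => L g + z) ⁻¹' (L '' A) := by
      ext z
      constructor
      · rintro ⟨x, hx, rfl⟩
        exact ⟨g + x, hx, by simp⟩
      · rintro ⟨x, hx, hxz⟩
        refine ⟨x - g, by simpa using hx, ?_⟩
        rw [map_sub, hxz]; simp
    rw [this, measure_preimage_add]⟩
  have heq := Measure.isAddLeftInvariant_eq_smul ν (volume : Measure (Fin d → ℝ))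
  set c := Measure.addHaarScalarFactor ν (volume : Measure (Fin d → ℝ)) with hc
  refine ⟨c, ?_, ENNReal.coe_ne_top, ?_⟩
  · intro h0
    have h1 : μH[(d : ℝ)] (L '' (Metric.ball 0 1)) = 0 := by
      rw [← hνA, heq]
      have : c = 0 := by exact_mod_cast h0
      simp [this]
    have h2 := hanti.le_hausdorffMeasure_image (d := d) (by positivity) (Metric.ball 0 1)
    rw [h1, mul_zero, hvol] at h2
    exact absurd h2 (not_le.2 (Metric.measure_ball_pos _ _ one_pos))
  · intro A hA
    have h1 : (fun y => v + L y) '' A = (fun z => -v + z) ⁻¹' (L '' A) := by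
      ext z
      constructor
      · rintro ⟨x, hx, rfl⟩
        exact ⟨x, hx, by simp⟩
      · rintro ⟨x, hx, hxz⟩
        exact ⟨x, hx, by simp [hxz]⟩
    rw [h1, measure_preimage_add, ← hνA, heq]
    rfl

/-- The scaling map. -/
noncomputable def scl (k : ℕ) : EuclideanSpace ℝ (Fin (k + 2)) ≃ₗ[ℝ] (Fin (k + 2) → ℝ) :=
  (WithLp.linearEquiv 2 ℝ (Fin (k + 2) → ℝ)).trans
    (LinearEquiv.smulOfNeZero ℝ _ ((k : ℝ) + 1) (by positivity))

lemma scl_apply (k : ℕ) (u : EuclideanSpace ℝ (Fin (k + 2))) (i : Fin (k + 2)) :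
    scl k u i = (k + 1) * u i := by
  simp [scl]

lemma mem_regular_iff (k : ℕ) (u : EuclideanSpace ℝ (Fin (k + 2))) :
    u ∈ regularPermE (k + 2) ↔ scl k u ∈ permutohedron (k + 2) (x0 (k + 2)) := by
  have hk : (k : ℝ) + 1 ≠ 0 := by positivity
  rw [regularPermE, permutohedronE, permutohedron]
  have h := (scl k).toLinearMap.image_convexHull
    {y | ∃ σ : Equiv.Perm (Fin (k + 2)), ∀ i, y i = ((WithLp.equiv 2 (Fin (k + 2) → ℝ)).symm
      fun i => (((k + 2 : ℕ) : ℝ) - 1 - (i : ℕ)) / (((k + 2 : ℕ) : ℝ) - 1)) (σ i)}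
  have e : (scl k).toLinearMap '' {y | ∃ σ : Equiv.Perm (Fin (k + 2)), ∀ i, y i =
      ((WithLp.equiv 2 (Fin (k + 2) → ℝ)).symm
      fun i => (((k + 2 : ℕ) : ℝ) - 1 - (i : ℕ)) / (((k + 2 : ℕ) : ℝ) - 1)) (σ i)} =
      {y | ∃ σ : Equiv.Perm (Fin (k + 2)), ∀ i, y i = x0 (k + 2) (σ i)} := by
    have hk2 : ((k + 2 : ℕ) : ℝ) - 1 = k + 1 := by push_cast; ring
    ext y
    constructor
    · rintro ⟨x, ⟨σ, hσ⟩, rfl⟩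
      refine ⟨σ, fun i => ?_⟩
      rw [LinearEquiv.coe_coe, scl_apply, hσ]
      simp only [WithLp.equiv_symm_apply, x0, hk2]
      field_simp
    · rintro ⟨σ, hσ⟩
      refine ⟨(scl k).symm y, ⟨σ, fun i => ?_⟩, by simp⟩
      have := scl_apply k ((scl k).symm y) i
      rw [LinearEquiv.apply_symm_apply, hσ] at this
      simp only [WithLp.equiv_symm_apply, x0, hk2] at this ⊢
      field_simp
      linarith
  rw [e] at h
  rw [← h]
  constructor
  · intro hu; exact ⟨u, hu, rfl⟩
  · rintro ⟨w, hw, hwu⟩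
    have : w = u := (scl k).injective hwu
    rwa [← this]

lemma perm_comp {n : ℕ} (x v : Fin n → ℝ) (σ : Equiv.Perm (Fin n))
    (hv : v ∈ permutohedron n x) : (fun i => v (σ i)) ∈ permutohedron n x := by
  rw [mem_iff] at hv ⊢
  intro c
  obtain ⟨τ, hτ⟩ := hv (fun i => c (σ⁻¹ i))
  refine ⟨σ.trans τ, ?_⟩
  rw [← Equiv.sum_comp σ, ← Equiv.sum_comp σ (fun i => c (σ⁻¹ i) * x (τ i))] at hτ
  simpa using hτ

lemma perm_closed {n : ℕ} (x : Fin n → ℝ) : IsClosed (permutohedron n x) := by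
  have hfin : {y : Fin n → ℝ | ∃ σ : Equiv.Perm (Fin n), ∀ i, y i = x (σ i)}.Finite := by
    refine (Set.finite_range (fun σ : Equiv.Perm (Fin n) => fun i => x (σ i))).subset ?_
    rintro y ⟨σ, hσ⟩
    exact ⟨σ, by ext i; simp [hσ]⟩
  exact hfin.isClosed_convexHull ℝ

lemma compl_continuous (m : ℕ) : Continuous (compl : (Fin m → ℝ) → (Fin (m + 1) → ℝ)) := by
  refine continuous_pi fun i => ?_
  refine Fin.lastCases ?_ (fun i => ?_) i
  · simp only [compl, Fin.snoc_last]; fun_prop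
  · simp only [compl, Fin.snoc_castSucc]; fun_prop

lemma Q_closed (m : ℕ) : IsClosed (Q m) := (perm_closed _).preimage (compl_continuous m)

lemma compl_restrict {m : ℕ} (z : Fin (m + 1) → ℝ)
    (hz : z ∈ permutohedron (m + 1) (x0 (m + 1))) : compl (fun i : Fin m => z i.castSucc) = z := by
  have hs := sum_of_mem m z hz
  rw [Fin.sum_univ_castSucc] at hs
  ext i
  refine Fin.lastCases ?_ (fun i => ?_) i
  · simp only [compl, Fin.snoc_last]; linarith
  · simp only [compl, Fin.snoc_castSucc]

lemma coord_bounds {k : ℕ} (z : Fin (k + 2) → ℝ)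
    (hz : z ∈ permutohedron (k + 2) (x0 (k + 2))) (i : Fin (k + 2)) :
    0 ≤ z i ∧ z i ≤ k + 1 := by
  rw [mem_iff] at hz
  obtain ⟨σ, h1⟩ := hz (Pi.single i 1)
  obtain ⟨τ, h2⟩ := hz (Pi.single i (-1))
  simp only [Pi.single_apply, ite_mul, one_mul, zero_mul, neg_mul, Finset.sum_ite_eq',
    Finset.mem_univ, if_true, x0] at h1 h2
  have h3 : (((τ i : Fin (k + 2)) : ℕ) : ℝ) ≤ k + 1 := by
    have := (τ i).isLt
    exact_mod_cast (by omega : (τ i : ℕ) ≤ k + 1)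
  have h4 : (0 : ℝ) ≤ (((σ i : Fin (k + 2)) : ℕ) : ℝ) := by positivity
  push_cast at h1 h2
  constructor <;> linarith

lemma uniform_map (k : ℕ) (B : Set ℝ) (hB : MeasurableSet B) :
    (uniformPerm (k + 2)).map (fun u => u 0) B =
      (volume (Q (k + 1)))⁻¹ * volume (Q (k + 1) ∩ {y | y 0 / ((k : ℝ) + 1) ∈ B}) := by
  have hk : (k : ℝ) + 1 ≠ 0 := by positivity
  -- linear part of the parametrization
  let L0 : (Fin (k + 1) → ℝ) →ₗ[ℝ] (Fin (k + 2) → ℝ) :=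
    { toFun := fun y => Fin.snoc y (-∑ i, y i)
      map_add' := fun x y => by
        ext i
        refine Fin.lastCases ?_ (fun i => ?_) i
        · simp [Finset.sum_add_distrib]; ring
        · simp
      map_smul' := fun c y => by
        ext i
        refine Fin.lastCases ?_ (fun i => ?_) i
        · simp [Finset.mul_sum]
        · simp }
  let v0 : Fin (k + 2) → ℝ := Fin.snoc (fun _ => 0) ((((k + 1 : ℕ) : ℝ) + 1) * (k + 1 : ℕ) / 2)
  have hcompl : ∀ y : Fin (k + 1) → ℝ, compl y = v0 + L0 y := by
    intro y
    ext i
    refine Fin.lastCases ?_ (fun i => ?_) i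
    · simp [compl, v0, L0]; ring
    · simp [compl, v0, L0]
  let L : (Fin (k + 1) → ℝ) →ₗ[ℝ] EuclideanSpace ℝ (Fin (k + 2)) :=
    (scl k).symm.toLinearMap ∘ₗ L0
  have hLinj : Function.Injective L := by
    refine (scl k).symm.injective.comp ?_
    intro x y hxy
    ext i
    have := congrFun hxy i.castSucc
    simpa [L0] using this
  obtain ⟨c, hc0, hct, hc⟩ := hausdorff_linear L hLinj ((scl k).symm v0)
  have hφ : ∀ y, (scl k).symm v0 + L y = (scl k).symm (compl y) := by
    intro y; rw [hcompl, map_add]; rfl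
  simp only [hφ] at hc
  have hd : ((k + 2 : ℕ) : ℝ) - 1 = ((k + 1 : ℕ) : ℝ) := by push_cast; ring
  have hcoord : Measurable (fun u : EuclideanSpace ℝ (Fin (k + 2)) => u 0) := by fun_prop
  have himg : ∀ B : Set ℝ, {u : EuclideanSpace ℝ (Fin (k + 2)) | u 0 ∈ B} ∩ regularPermE (k + 2) =
      (fun y => (scl k).symm (compl y)) '' (Q (k + 1) ∩ {y | y 0 / ((k : ℝ) + 1) ∈ B}) := by
    intro B
    ext u
    constructor
    · rintro ⟨hu, hur⟩
      rw [mem_regular_iff] at hur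
      have h1 := compl_restrict _ hur
      refine ⟨fun i => scl k u i.castSucc, ⟨?_, ?_⟩, ?_⟩
      · rw [Q, Set.mem_ofPred_eq, h1]; exact hur
      · simp only [Set.mem_ofPred_eq, scl_apply, Fin.castSucc_zero] at hu ⊢
        rwa [mul_div_cancel_left₀ _ hk]
      · simp only [h1, LinearEquiv.symm_apply_apply]
    · rintro ⟨y, ⟨hy, hyB⟩, rfl⟩
      refine ⟨?_, ?_⟩
      · have h1 := scl_apply k ((scl k).symm (compl y)) 0
        rw [LinearEquiv.apply_symm_apply] at h1
        have h2 : compl y 0 = y 0 := by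
          rw [← Fin.castSucc_zero]; simp only [compl, Fin.snoc_castSucc]
        simp only [Set.mem_ofPred_eq] at hyB ⊢
        rw [h2] at h1
        rwa [h1, mul_div_cancel_left₀ _ hk] at hyB
      · rw [mem_regular_iff, LinearEquiv.apply_symm_apply]; exact hy
  have hQm : MeasurableSet (Q (k + 1)) := (Q_closed _).measurableSet
  have htot : μH[((k + 1 : ℕ) : ℝ)] (regularPermE (k + 2)) = c * volume (Q (k + 1)) := by
    have := himg Set.univ
    simp only [Set.mem_univ, Set.ofPred_true, Set.univ_inter, Set.inter_univ] at this
    rw [this, hc _ hQm]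
  rw [Measure.map_apply hcoord hB, uniformPerm, hd, Measure.smul_apply,
    Measure.restrict_apply (hcoord hB), smul_eq_mul, htot]
  have := himg B
  rw [show (fun u : EuclideanSpace ℝ (Fin (k + 2)) => u 0) ⁻¹' B = {u | u 0 ∈ B} from rfl, this,
    hc _ (hQm.inter (by
      have : Measurable (fun y : Fin (k + 1) → ℝ => y 0 / ((k : ℝ) + 1)) := by fun_prop
      exact this hB))]
  rw [ENNReal.mul_inv (Or.inl hc0) (Or.inl hct), mul_mul_mul_comm, ENNReal.inv_mul_cancel hc0 hct,
    one_mul]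

lemma uniform_symm (k : ℕ) (i i' : Fin (k + 2)) :
    (uniformPerm (k + 2)).map (fun u => u i) = (uniformPerm (k + 2)).map (fun u => u i') := by
  ext B hB
  have hm : ∀ i, Measurable (fun u : EuclideanSpace ℝ (Fin (k + 2)) => u i) := by
    intro i; fun_prop
  rw [Measure.map_apply (hm i) hB, Measure.map_apply (hm i') hB, uniformPerm, Measure.smul_apply,
    Measure.smul_apply, Measure.restrict_apply (hm i hB), Measure.restrict_apply (hm i' hB)]
  congr 1
  let e := LinearIsometryEquiv.piLpCongrLeft 2 ℝ ℝ (Equiv.swap i i')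
  have he : ∀ u j, e u j = u (Equiv.swap i i' j) := by
    intro u j
    simp [e, LinearIsometryEquiv.piLpCongrLeft_apply, Equiv.piCongrLeft'_apply]
  have hreg : ∀ u, u ∈ regularPermE (k + 2) → e u ∈ regularPermE (k + 2) := by
    intro u hu
    rw [mem_regular_iff] at hu ⊢
    have := perm_comp _ _ (Equiv.swap i i') hu
    convert this using 1
    ext j
    rw [scl_apply, scl_apply, he]
  have hee : ∀ u, e (e u) = u := by
    intro u; ext j; rw [he, he, Equiv.swap_apply_self]
  rw [← e.toIsometryEquiv.hausdorffMeasure_preimage]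
  congr 1
  ext u
  simp only [Set.mem_preimage, Set.mem_inter_iff, LinearIsometryEquiv.coe_toIsometryEquiv, he,
    Equiv.swap_apply_left]
  refine and_congr Iff.rfl ⟨fun h => ?_, fun h => hreg _ h⟩
  have := hreg _ h
  rwa [hee] at this


/-- slice volume -/
noncomputable def slice (k : ℕ) (t : ℝ) : Set (Fin k → ℝ) :=
  {w | (Fin.cons t w : Fin (k + 1) → ℝ) ∈ Q (k + 1)}

lemma measurable_consP (k : ℕ) :
    Measurable (fun p : ℝ × (Fin k → ℝ) => (Fin.cons p.1 p.2 : Fin (k + 1) → ℝ)) := by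
  refine measurable_pi_lambda _ fun i => ?_
  refine Fin.cases ?_ (fun i => ?_) i
  · simp only [Fin.cons_zero]; fun_prop
  · simp only [Fin.cons_succ]; fun_prop

lemma measurable_slice (k : ℕ) : Measurable (fun t => volume (slice k t)) :=
  measurable_measure_prodMk_left (ν := (volume : Measure (Fin k → ℝ)))
    (measurable_consP k (Q_closed (k + 1)).measurableSet)

lemma slice_mem_bounds (k : ℕ) (t : ℝ) (w : Fin k → ℝ) (hw : w ∈ slice k t) :
    (0 ≤ t ∧ t ≤ k + 1) ∧ ∀ i, 0 ≤ w i ∧ w i ≤ k + 1 := by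
  have hw' : compl (Fin.cons t w : Fin (k + 1) → ℝ) ∈ permutohedron (k + 2) (x0 (k + 2)) := hw
  have h := fun i : Fin (k + 1) => coord_bounds _ hw' i.castSucc
  simp only [compl, Fin.snoc_castSucc] at h
  exact ⟨by simpa using h 0, fun i => by simpa using h i.succ⟩

lemma slice_finite (k : ℕ) (t : ℝ) : volume (slice k t) ≠ ⊤ := by
  refine ne_top_of_le_ne_top ?_ (measure_mono (t := Set.Icc (fun _ => 0) (fun _ => (k : ℝ) + 1)) ?_)
  · exact isCompact_Icc.measure_lt_top.ne
  · intro w hw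
    have h := (slice_mem_bounds k t w hw).2
    exact ⟨fun i => (h i).1, fun i => (h i).2⟩

lemma volume_inter (k : ℕ) (B : Set ℝ) (hB : MeasurableSet B) :
    volume (Q (k + 1) ∩ {y | y 0 / ((k : ℝ) + 1) ∈ B}) =
      ENNReal.ofReal ((k : ℝ) + 1) * ∫⁻ u in B, volume (slice k (((k : ℝ) + 1) * u)) := by
  have hk : (k : ℝ) + 1 ≠ 0 := by positivity
  have hmd : Measurable (fun t : ℝ => t / ((k : ℝ) + 1)) := by fun_prop
  have hA : MeasurableSet (Q (k + 1) ∩ {y | y 0 / ((k : ℝ) + 1) ∈ B}) :=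
    (Q_closed _).measurableSet.inter (by
      have : Measurable (fun y : Fin (k + 1) → ℝ => y 0 / ((k : ℝ) + 1)) := by fun_prop
      exact this hB)
  have hmp := (volume_preserving_piFinSuccAbove (fun _ : Fin (k + 1) => ℝ) 0).symm
  rw [← hmp.measure_preimage hA.nullMeasurableSet, Measure.volume_eq_prod,
    Measure.prod_apply (hmp.measurable hA)]
  have h1 : ∀ t : ℝ, volume (Prod.mk t ⁻¹'
      ((MeasurableEquiv.piFinSuccAbove (fun _ : Fin (k + 1) => ℝ) 0).symm ⁻¹'
        (Q (k + 1) ∩ {y | y 0 / ((k : ℝ) + 1) ∈ B}))) =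
      ((fun t : ℝ => t / ((k : ℝ) + 1)) ⁻¹' B).indicator (fun t => volume (slice k t)) t := by
    intro t
    have hs : ∀ w : Fin k → ℝ, (MeasurableEquiv.piFinSuccAbove (fun _ : Fin (k + 1) => ℝ) 0).symm
        (t, w) = Fin.cons t w := by
      intro w; simp [MeasurableEquiv.piFinSuccAbove]; rfl
    by_cases ht : t / ((k : ℝ) + 1) ∈ B
    · rw [Set.indicator_of_mem (by exact ht)]
      congr 1
      ext w
      simp only [Set.mem_preimage, hs, Set.mem_inter_iff, Set.mem_ofPred_eq, Fin.cons_zero, ht,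
        and_true, slice]
    · rw [Set.indicator_of_notMem (by exact ht)]
      convert measure_empty (μ := (volume : Measure (Fin k → ℝ)))
      ext w
      simp only [Set.mem_preimage, hs, Set.mem_inter_iff, Set.mem_ofPred_eq, Fin.cons_zero, ht,
        and_false, Set.mem_empty_iff_false]
  simp only [h1]
  conv_lhs => rw [← Real.smul_map_volume_mul_left hk]
  rw [lintegral_smul_measure, lintegral_map ((measurable_slice k).indicator (hmd hB))
    (measurable_const_mul _), abs_of_pos (by positivity), smul_eq_mul, ← lintegral_indicator hB]
  congr 1
  refine lintegral_congr fun u => ?_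
  by_cases hu : u ∈ B
  · rw [Set.indicator_of_mem hu, Set.indicator_of_mem]
    simpa [mul_div_cancel_left₀ _ hk] using hu
  · rw [Set.indicator_of_notMem hu, Set.indicator_of_notMem]
    simpa [mul_div_cancel_left₀ _ hk] using hu

lemma slice_eq (k j : ℕ) (h1 : 1 ≤ j) (h2 : j ≤ k + 1) (u : ℝ)
    (hu1 : (j : ℝ) - 1 ≤ (k + 1) * u) (hu2 : (k + 1) * u ≤ j) :
    (fun (y : Fin (k + 1) → ℝ) (i : Fin k) => y i.castSucc) ''
      permutohedron (k + 1) (sectionVec (k + 2) j u) = slice k ((k + 1) * u) := by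
  ext w
  constructor
  · rintro ⟨v, hv, rfl⟩
    rw [← section_iff k j h1 h2 u hu1 hu2] at hv
    have := compl_restrict _ hv
    simp only [slice, Q, Set.mem_ofPred_eq]
    convert hv using 1
    rw [← this]
    congr 1
    ext i
    refine Fin.cases ?_ (fun i => ?_) i
    · simp
    · rw [← Fin.succ_castSucc, Fin.cons_succ, Fin.cons_succ]
  · intro hw
    simp only [slice, Q, Set.mem_ofPred_eq, compl] at hw
    rw [← Fin.cons_snoc_eq_snoc_cons] at hw
    have := (section_iff k j h1 h2 u hu1 hu2 _).1 hw
    exact ⟨_, this, by ext i; simp⟩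

end PermAux

/-- Lemma 3: if `(u_1, …, u_n)` is uniformly distributed on `Π_n`
(`n ≥ 2`), the marginals of the coordinates are identical and absolutely continuous
with respect to Lebesgue measure on `[0,1]`, with density
`l_n(u) = ((n-1)/n^{n-2}) Vol_{n-2}(P_{n-1}(n-1, …, j+1, 2j-1-(n-1)u, j-2, …, 0))`
for `u ∈ [(j-1)/(n-1), j/(n-1)]`, `j = 1, …, n-1` (and `l_n = 0` off `[0,1]`). -/
theorem stmt8 (n : ℕ) (hn : 2 ≤ n) :
    (∀ i i' : Fin n,
      (uniformPerm n).map (fun u => u i) = (uniformPerm n).map (fun u => u i')) ∧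
    ∃ l : ℝ → ℝ,
      (∀ i : Fin n,
        (uniformPerm n).map (fun u => u i)
          = volume.withDensity fun u => ENNReal.ofReal (l u)) ∧
      (∀ j : ℕ, 1 ≤ j → j ≤ n - 1 →
        ∀ u ∈ Set.Icc (((j : ℝ) - 1) / ((n : ℝ) - 1)) ((j : ℝ) / ((n : ℝ) - 1)),
          l u = (((n : ℝ) - 1) / (n : ℝ) ^ (n - 2)) *
            permVol (n - 1) (permutohedron (n - 1) (sectionVec n j u))) ∧
      (∀ u : ℝ, u ∉ Set.Icc (0 : ℝ) 1 → l u = 0) := by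
  obtain ⟨k, rfl⟩ : ∃ k, n = k + 2 := ⟨n - 2, by omega⟩
  have hk : (0 : ℝ) < (k : ℝ) + 1 := by positivity
  have hN : ((k + 2 : ℕ) : ℝ) - 1 = k + 1 := by push_cast; ring
  have hpow : (0 : ℝ) < ((k : ℝ) + 2) ^ k := by positivity
  refine ⟨PermAux.uniform_symm k, fun u => (((k : ℝ) + 1) / ((k : ℝ) + 2) ^ k) *
    (volume (PermAux.slice k (((k : ℝ) + 1) * u))).toReal, ?_, ?_, ?_⟩
  · intro i
    rw [PermAux.uniform_symm k i 0]
    ext B hB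
    have hms : Measurable (fun u : ℝ => volume (PermAux.slice k (((k : ℝ) + 1) * u))) :=
      (PermAux.measurable_slice k).comp (measurable_const_mul _)
    rw [PermAux.uniform_map k B hB, PermAux.volume_inter k B hB, PermAux.volume_Q,
      withDensity_apply _ hB, ← mul_assoc, ← lintegral_const_mul _ hms]
    refine lintegral_congr fun u => ?_
    rw [ENNReal.ofReal_mul (by positivity), ENNReal.ofReal_toReal (PermAux.slice_finite k _),
      ENNReal.ofReal_div_of_pos hpow, div_eq_mul_inv, mul_comm (ENNReal.ofReal _)⁻¹]
  · intro j h1 h2 u hu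
    rw [hN] at hu ⊢
    obtain ⟨hu1, hu2⟩ := hu
    rw [div_le_iff₀ hk] at hu1
    rw [le_div_iff₀ hk] at hu2
    have := PermAux.slice_eq k j h1 h2 u (by linarith) (by linarith)
    simp only [← this]
    push_cast
    rfl
  · intro u hu
    have : PermAux.slice k (((k : ℝ) + 1) * u) = ∅ := by
      ext w
      simp only [Set.mem_empty_iff_false, iff_false]
      intro hw
      have h := (PermAux.slice_mem_bounds k _ w hw).1
      apply hu
      constructor
      · by_contra hneg
        nlinarith [not_le.1 hneg]
      · by_contra hneg
        nlinarith [not_le.1 hneg]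
    simp [this]
end

section
/- For n ≥ 2, the marginal density l_n of a coordinate of a uniform random vector on Π_n satisfies l_n(0) = l_n(1) = (1 − 1/n)^{n−2}; equivalently, ((n−1)/n^{n−2}) · Vol_{n−2}( P_{n−1}(n−1, n−2, …, 2, 1) ) = (1 − 1/n)^{n−2}. -/
open MeasureTheory

namespace PermVol

/-- Sum of the `k` largest entries. -/
noncomputable def bd (a : ℝ) (k : ℕ) : ℝ := k * a - k * ((k : ℝ) - 1) / 2

lemma sum_ge_aux (s : Finset ℕ) : (s.card : ℝ) * ((s.card : ℝ) - 1) / 2 ≤ ∑ i ∈ s, (i : ℝ) := by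
  induction s using Finset.induction_on_max with
  | empty => simp
  | insert x s hx ih =>
    have hnot : x ∉ s := fun h => lt_irrefl _ (hx x h)
    rw [Finset.sum_insert hnot, Finset.card_insert_of_notMem hnot]
    have hc : s.card ≤ x := by
      have : s ⊆ Finset.range x := fun i hi => Finset.mem_range.2 (hx i hi)
      simpa using Finset.card_le_card this
    have hc' : (s.card : ℝ) ≤ x := by exact_mod_cast hc
    push_cast
    nlinarith

lemma sum_id_fin (m : ℕ) : ∑ i : Fin m, ((i : ℕ) : ℝ) = (m : ℝ) * ((m : ℝ) - 1) / 2 := by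
  induction m with
  | zero => simp
  | succ k ih =>
    rw [Fin.sum_univ_castSucc]
    simp only [Fin.val_castSucc, Fin.val_last]
    rw [ih]; push_cast; ring

lemma sum_vertex (a : ℝ) (m : ℕ) : ∑ i : Fin m, (a - ((i : ℕ) : ℝ)) = bd a m := by
  rw [Finset.sum_sub_distrib, sum_id_fin]; simp [bd]

/-- The inequality description of the permutohedron. -/
def Rado (a : ℝ) (m : ℕ) (x : Fin m → ℝ) : Prop :=
  ∑ i, x i = bd a m ∧ ∀ S : Finset (Fin m), ∑ i ∈ S, x i ≤ bd a S.card

lemma rado_vertex (a : ℝ) (m : ℕ) (σ : Equiv.Perm (Fin m)) :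
    Rado a m (fun i => a - ((σ i : ℕ) : ℝ)) := by
  refine ⟨?_, fun S => ?_⟩
  · rw [Equiv.sum_comp σ (fun i : Fin m => a - ((i : ℕ) : ℝ))]; exact sum_vertex a m
  · have h := sum_ge_aux (S.map (σ.toEmbedding.trans Fin.valEmbedding))
    rw [Finset.sum_map, Finset.card_map] at h
    simp only [Function.Embedding.trans_apply, Equiv.coe_toEmbedding, Fin.valEmbedding_apply] at h
    rw [Finset.sum_sub_distrib]
    simp only [Finset.sum_const, nsmul_eq_mul, bd]
    linarith

lemma rado_convex (a : ℝ) (m : ℕ) : Convex ℝ {x | Rado a m x} := by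
  intro x hx y hy s t hs ht hst
  refine ⟨?_, fun S => ?_⟩
  · simp only [Pi.add_apply, Pi.smul_apply, smul_eq_mul, Finset.sum_add_distrib, ← Finset.mul_sum]
    rw [hx.1, hy.1, ← add_mul, hst, one_mul]
  · simp only [Pi.add_apply, Pi.smul_apply, smul_eq_mul, Finset.sum_add_distrib, ← Finset.mul_sum]
    have h1 := mul_le_mul_of_nonneg_left (hx.2 S) hs
    have h2 := mul_le_mul_of_nonneg_left (hy.2 S) ht
    have : bd a S.card = s * bd a S.card + t * bd a S.card := by rw [← add_mul, hst, one_mul]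
    linarith

lemma abel (p D : ℕ → ℝ) (n : ℕ) (hp : ∀ i, i < n → p (i+1) ≤ p i)
    (hD : ∀ k, k ≤ n → ∑ i ∈ Finset.range k, D i ≤ 0) :
    ∑ i ∈ Finset.range (n+1), p i * D i ≤ p n * ∑ i ∈ Finset.range (n+1), D i := by
  induction n with
  | zero => simp
  | succ n ih =>
    have h1 := ih (fun i hi => hp i (by omega)) (fun k hk => hD k (by omega))
    rw [Finset.sum_range_succ, Finset.sum_range_succ D (n+1)]
    have h2 := hD (n+1) le_rfl
    have h3 := hp n (by omega)
    nlinarith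

lemma abel_fin (d : ℕ) (p D : Fin (d+1) → ℝ) (hp : Antitone p)
    (hD : ∀ k : ℕ, k ≤ d → ∑ i with (i : Fin (d+1)).val < k, D i ≤ 0) (h0 : ∑ i, D i = 0) :
    ∑ i, p i * D i ≤ 0 := by
  let e : (Fin (d+1) → ℝ) → ℕ → ℝ := fun f n => if h : n < d+1 then f ⟨n, h⟩ else 0
  have he : ∀ f (i : Fin (d+1)), f i = e f i := fun f i => by simp only [e, i.isLt, dite_true]
  have h := abel (e p) (e D) d ?_ ?_
  · rw [← Fin.sum_univ_eq_sum_range, ← Fin.sum_univ_eq_sum_range (e D)] at h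
    simp only [← he] at h
    rw [h0, mul_zero] at h
    exact h
  · intro i hi
    simp only [e, show i + 1 < d + 1 by omega, show i < d+1 by omega, dite_true]
    apply hp; simp
  · intro k hk
    convert hD k hk using 1
    rw [Finset.sum_filter]
    simp only [he D]
    rw [Fin.sum_univ_eq_sum_range (fun i => if i < k then e D i else 0), ← Finset.sum_filter]
    congr 1
    ext i; simp; omega

lemma mem_perm_iff (a : ℝ) (d : ℕ) (x : Fin (d+1) → ℝ) :
    x ∈ permutohedron (d+1) (fun i => a - ((i : ℕ) : ℝ)) ↔ Rado a (d+1) x := by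
  constructor
  · intro h
    refine (convexHull_min ?_ (rado_convex a (d+1))) h
    rintro y ⟨σ, hσ⟩
    have : y = fun i => a - ((σ i : ℕ) : ℝ) := funext hσ
    rw [this]; exact rado_vertex a _ σ
  · intro hx
    by_contra hn
    have hfin : Set.Finite {y : Fin (d+1) → ℝ | ∃ σ : Equiv.Perm (Fin (d+1)), ∀ i, y i = a - ((σ i : ℕ) : ℝ)} := by
      refine (Set.finite_range (fun (σ : Equiv.Perm (Fin (d+1))) i => a - ((σ i : ℕ) : ℝ))).subset ?_
      rintro y ⟨σ, hσ⟩
      exact ⟨σ, (funext hσ).symm⟩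
    obtain ⟨f, u, hf, hu⟩ := geometric_hahn_banach_closed_point (convex_convexHull ℝ _)
      (hfin.isClosed_convexHull ℝ) hn
    set c : Fin (d+1) → ℝ := fun i => f (Pi.single i 1) with hc
    have hfc : ∀ y, f y = ∑ i, c i * y i := by
      intro y
      conv_lhs => rw [← Finset.univ_sum_single y]
      rw [map_sum]
      refine Finset.sum_congr rfl fun i _ => ?_
      have : (Pi.single i (y i) : Fin (d+1) → ℝ) = y i • Pi.single i 1 := by
        rw [← Pi.single_smul]; simp
      rw [this, map_smul, smul_eq_mul, mul_comm]
    let τ := Tuple.sort (fun i => - c i)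
    have hτ : Antitone (fun i => c (τ i)) := by
      intro i j hij
      have := Tuple.monotone_sort (fun i => - c i) hij
      simp only [Function.comp] at this
      exact neg_le_neg_iff.1 this
    have h1 := hf (fun i => a - ((τ.symm i : ℕ) : ℝ)) (subset_convexHull _ _ ⟨τ.symm, fun i => rfl⟩)
    have h2 := abel_fin d (fun i => c (τ i)) (fun i => x (τ i) - (a - ((i : ℕ) : ℝ))) hτ ?_ ?_
    · rw [hfc] at h1 hu
      rw [← Equiv.sum_comp τ] at h1 hu
      simp only [mul_sub, Finset.sum_sub_distrib, Equiv.symm_apply_apply] at h1 h2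
      linarith
    · intro k hk
      have h := hx.2 (Finset.map τ.toEmbedding {i : Fin (d+1) | i.val < k})
      rw [Finset.sum_map, Finset.card_map] at h
      have hcard : (Finset.filter (fun i : Fin (d+1) => i.val < k) Finset.univ).card = k := by
        rw [Fin.card_filter_val_lt]; omega
      rw [hcard] at h
      rw [Finset.sum_sub_distrib, sub_nonpos]
      refine le_trans h (le_of_eq ?_)
      rw [← sum_vertex, Finset.sum_filter,
        Fin.sum_univ_eq_sum_range (fun i => a - (i : ℝ)) k,
        Fin.sum_univ_eq_sum_range (fun i => if i < k then a - (i : ℝ) else 0) (d+1), ← Finset.sum_filter]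
      congr 1
      ext i; simp; omega
    · rw [Finset.sum_sub_distrib, sum_vertex, Equiv.sum_comp τ x, hx.1, sub_self]


/-- Lattice vectors, with all `d+1` coordinates. -/
def IsLat (d : ℕ) (z : Fin (d+1) → ℤ) : Prop :=
  ∑ i, z i = 0 ∧ ∀ i j, ((d+1 : ℕ) : ℤ) ∣ z i - z j

lemma IsLat.add {d : ℕ} {z w : Fin (d+1) → ℤ} (hz : IsLat d z) (hw : IsLat d w) :
    IsLat d (z + w) := by
  refine ⟨by simp [Finset.sum_add_distrib, hz.1, hw.1], fun i j => ?_⟩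
  have := dvd_add (hz.2 i j) (hw.2 i j)
  rwa [show (z + w) i - (z + w) j = z i - z j + (w i - w j) by simp only [Pi.add_apply]; ring]

lemma IsLat.neg {d : ℕ} {z : Fin (d+1) → ℤ} (hz : IsLat d z) : IsLat d (-z) := by
  refine ⟨by simp [hz.1], fun i j => ?_⟩
  have := (hz.2 j i)
  rwa [show (-z) i - (-z) j = z j - z i by simp only [Pi.neg_apply]; ring]

/-- The projected lattice. -/
def Lat (d : ℕ) : AddSubgroup (Fin d → ℝ) where
  carrier := {g | ∃ z, IsLat d z ∧ ∀ i, g i = (z (Fin.castSucc i) : ℝ)}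
  zero_mem' := ⟨0, ⟨by simp, by simp⟩, by simp⟩
  add_mem' := by
    rintro g h ⟨z, hz, hg⟩ ⟨w, hw, hh⟩
    exact ⟨z + w, hz.add hw, fun i => by simp [hg, hh]⟩
  neg_mem' := by
    rintro g ⟨z, hz, hg⟩
    exact ⟨-z, hz.neg, fun i => by simp [hg]⟩

lemma isLat_mk (d : ℕ) (c : ℤ) (t : Fin d → ℤ) :
    IsLat d (Fin.snoc (α := fun _ => ℤ) (fun i => c + (d+1 : ℕ) * t i)
      (-∑ i, (c + (d+1 : ℕ) * t i))) := by
  set z : Fin (d+1) → ℤ := (Fin.snoc (α := fun _ => ℤ) (fun i => c + (d+1 : ℕ) * t i)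
      (-∑ i, (c + (d+1 : ℕ) * t i))) with hz
  have hc : ∀ i, ((d+1 : ℕ) : ℤ) ∣ z i - c := by
    intro i
    refine Fin.lastCases ?_ (fun i => ?_) i
    · refine ⟨-c - ∑ i, t i, ?_⟩
      simp only [hz, Fin.snoc_last, Finset.sum_add_distrib, ← Finset.mul_sum]
      simp; ring
    · exact ⟨t i, by simp [hz]⟩
  refine ⟨?_, fun i j => ?_⟩
  · rw [Fin.sum_univ_castSucc]; simp [hz]
  · have := dvd_sub (hc i) (hc j)
    rwa [show z i - c - (z j - c) = z i - z j by ring] at this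

instance (d : ℕ) : Countable (Lat d) := by
  have : Function.Injective (fun g : Lat d => (g.2.choose : Fin (d+1) → ℤ)) := by
    intro g h hgh
    ext i
    have h1 := g.2.choose_spec.2 i
    have h2 := h.2.choose_spec.2 i
    simp only at hgh
    rw [h1, h2, hgh]
  exact this.countable

/-- the box -/
def box (e : ℕ) : Set (Fin (e+1) → ℝ) :=
  Set.pi Set.univ fun i => Set.Ico (0:ℝ) (if i = 0 then 1 else ((e+2 : ℕ) : ℝ))

lemma box_fd (e : ℕ) : IsAddFundamentalDomain (Lat (e+1)) (box e) volume := by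
  refine IsAddFundamentalDomain.mk' ?_ fun x => ?_
  · exact (MeasurableSet.univ_pi fun i => measurableSet_Ico).nullMeasurableSet
  · have hm : (0:ℝ) < ((e+2 : ℕ) : ℝ) := by positivity
    obtain ⟨c, hc⟩ : ∃ c : ℤ, c = -⌊x 0⌋ := ⟨_, rfl⟩
    set t : Fin (e+1) → ℤ := fun i => if i = 0 then 0 else -⌊(x i + c) / ((e+2 : ℕ) : ℝ)⌋ with ht
    refine existsUnique_of_exists_of_unique ?_ ?_
    · refine ⟨⟨fun i => ((c + (e+1+1 : ℕ) * t i : ℤ) : ℝ), _, isLat_mk (e+1) c t, fun i => by simp⟩, ?_⟩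
      rintro i -
      rw [AddSubgroup.vadd_def]
      simp only [vadd_eq_add, Pi.add_apply]
      by_cases hi : i = 0
      · subst hi
        simp only [ht, hc, if_true, mul_zero, add_zero]
        push_cast
        constructor
        · linarith [Int.floor_le (x 0)]
        · linarith [Int.lt_floor_add_one (x 0)]
      · simp only [ht, if_neg hi]
        have h1 := Int.floor_le ((x i + c) / ((e+2 : ℕ) : ℝ))
        have h2 := Int.lt_floor_add_one ((x i + c) / ((e+2 : ℕ) : ℝ))
        rw [le_div_iff₀ hm] at h1
        rw [div_lt_iff₀ hm] at h2
        rw [Int.cast_add, Int.cast_mul, Int.cast_neg, Int.cast_natCast, show e + 1 + 1 = e + 2 from rfl]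
        constructor <;> nlinarith
    · intro g g' hg hg'
      obtain ⟨g, z, hz, hgz⟩ := g
      obtain ⟨g', w, hw, hgw⟩ := g'
      have h1 : ∀ i : Fin (e+1), |((z i.castSucc - w i.castSucc : ℤ) : ℝ)| < (if i = 0 then 1 else ((e+2 : ℕ) : ℝ)) := by
        intro i
        have a1 := hg i trivial
        have a2 := hg' i trivial
        rw [AddSubgroup.vadd_def] at a1 a2
        simp only [vadd_eq_add, Pi.add_apply, Set.mem_Ico, hgz, hgw] at a1 a2
        rw [abs_lt, Int.cast_sub]
        constructor <;> linarith [a1.1, a1.2, a2.1, a2.2]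
      have h0 : z (Fin.castSucc 0) - w (Fin.castSucc 0) = 0 := by
        have := h1 0
        simp only [if_true] at this
        exact Int.abs_lt_one_iff.1 (by exact_mod_cast this)
      ext i
      simp only [hgz, hgw]
      have h2 : z i.castSucc - w i.castSucc = 0 := by
        by_cases hi : i = 0
        · subst hi; exact h0
        · have h3 := h1 i
          rw [if_neg hi] at h3
          have h4 : |z i.castSucc - w i.castSucc| < ((e+2 : ℕ) : ℤ) := by exact_mod_cast h3
          refine Int.eq_zero_of_abs_lt_dvd (m := ((e+2 : ℕ) : ℤ)) ?_ h4
          have h5 := dvd_sub (hz.2 i.castSucc (Fin.castSucc 0)) (hw.2 i.castSucc (Fin.castSucc 0))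
          rwa [show z i.castSucc - z (Fin.castSucc 0) - (w i.castSucc - w (Fin.castSucc 0)) =
            z i.castSucc - w i.castSucc by linarith] at h5
      exact_mod_cast sub_eq_zero.1 h2

lemma box_vol (e : ℕ) : (volume (box e)).toReal = ((e : ℝ)+2)^e := by
  rw [box, Real.volume_pi_Ico_toReal]
  · simp [Fin.prod_univ_succ]
  · intro i
    dsimp only
    split_ifs <;> positivity

/-- extend to the last coordinate -/
noncomputable def ext (a : ℝ) {d : ℕ} (y : Fin d → ℝ) : Fin (d+1) → ℝ :=
  Fin.snoc (α := fun _ => ℝ) y (bd a (d+1) - ∑ i, y i)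

lemma ext_sum (a : ℝ) {d : ℕ} (y : Fin d → ℝ) : ∑ i, ext a y i = bd a (d+1) := by
  rw [Fin.sum_univ_castSucc]; simp [ext]

/-- projected permutohedron -/
def PP (a : ℝ) (d : ℕ) : Set (Fin d → ℝ) := {y | Rado a (d+1) (ext a y)}

lemma permVol_eq (a : ℝ) (d : ℕ) :
    permVol (d+1) (permutohedron (d+1) (fun i => a - ((i : ℕ) : ℝ))) = (volume (PP a d)).toReal := by
  unfold permVol
  congr 2
  ext y
  constructor
  · rintro ⟨x, hx, rfl⟩
    rw [mem_perm_iff] at hx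
    have : ext a (fun i : Fin d => x (Fin.castSucc i)) = x := by
      funext i
      refine Fin.lastCases ?_ (fun i => ?_) i
      · have := hx.1
        rw [Fin.sum_univ_castSucc] at this
        simp only [ext, Fin.snoc_last]; linarith
      · simp [ext]
    show Rado a (d+1) (ext a (fun i : Fin d => x (Fin.castSucc i)))
    rw [this]; exact hx
  · intro hy
    refine ⟨ext a y, (mem_perm_iff a d _).2 hy, ?_⟩
    funext i
    exact Fin.snoc_castSucc (α := fun _ => ℝ) _ _ i

/-- real cast of an extended lattice vector adds -/
lemma ext_add (a : ℝ) {d : ℕ} (y g : Fin d → ℝ) (z : Fin (d+1) → ℤ) (hz : IsLat d z)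
    (hg : ∀ i, g i = (z (Fin.castSucc i) : ℝ)) (i : Fin (d+1)) :
    ext a (g + y) i = z i + ext a y i := by
  refine Fin.lastCases ?_ (fun i => ?_) i
  · have h := hz.1
    rw [Fin.sum_univ_castSucc] at h
    have h' : ∑ i : Fin d, (z (Fin.castSucc i) : ℝ) + z (Fin.last d) = 0 := by exact_mod_cast h
    simp only [ext, Fin.snoc_last, Pi.add_apply, Finset.sum_add_distrib, hg]
    linarith
  · simp [ext, hg]

lemma null_hyper {d : ℕ} (S : Finset (Fin d)) (hS : S.Nonempty) (c : ℝ) :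
    volume {y : Fin d → ℝ | ∑ i ∈ S, y i = c} = 0 := by
  obtain ⟨j, hj⟩ := hS
  let φ : (Fin d → ℝ) →ₗ[ℝ] ℝ := ∑ i ∈ S, LinearMap.proj i
  have hφ : ∀ y, φ y = ∑ i ∈ S, y i := fun y => by simp [φ]
  have hk : volume ((LinearMap.ker φ : Submodule ℝ (Fin d → ℝ)) : Set (Fin d → ℝ)) = 0 := by
    refine Measure.addHaar_submodule _ _ fun h => ?_
    have : Pi.single j (1:ℝ) ∈ LinearMap.ker φ := by rw [h]; trivial
    rw [LinearMap.mem_ker, hφ, Finset.sum_pi_single'] at this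
    simp [hj] at this
  have : {y : Fin d → ℝ | ∑ i ∈ S, y i = c} = (fun y => y + Pi.single j (-c)) ⁻¹' (LinearMap.ker φ : Set (Fin d → ℝ)) := by
    ext y
    simp only [Set.mem_ofPred_eq, Set.mem_preimage, SetLike.mem_coe, LinearMap.mem_ker, map_add]
    rw [hφ, hφ, Finset.sum_pi_single', if_pos hj]
    constructor <;> intro h <;> linarith
  rw [this, measure_preimage_add_right, hk]

lemma null_ext (a : ℝ) {d : ℕ} (S : Finset (Fin (d+1))) (hS : S.Nonempty) (hS' : S ≠ Finset.univ)
    (c : ℝ) : volume {y : Fin d → ℝ | ∑ i ∈ S, ext a y i = c} = 0 := by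
  have key : ∀ S : Finset (Fin (d+1)), S.Nonempty → Fin.last d ∉ S → ∀ c,
      volume {y : Fin d → ℝ | ∑ i ∈ S, ext a y i = c} = 0 := by
    intro S hS hl c
    let S' : Finset (Fin d) := Finset.univ.filter fun i => i.castSucc ∈ S
    have hSS : S = S'.map Fin.castSuccEmb := by
      ext i
      refine Fin.lastCases ?_ (fun i => ?_) i
      · simp [hl, S']
      · simp [S']
    have hne : S'.Nonempty := by
      rw [hSS] at hS; simpa using hS
    rw [hSS]
    simp only [Finset.sum_map]
    convert null_hyper S' hne c using 5
    simp [ext]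
  by_cases hl : Fin.last d ∈ S
  · have h := key Sᶜ ?_ (by simpa using hl) (bd a (d+1) - c)
    · convert h using 4 with y
      have h1 := Finset.sum_add_sum_compl S (ext a y)
      rw [ext_sum] at h1
      constructor <;> intro h <;> linarith
    · rw [Finset.nonempty_iff_ne_empty]
      simpa using hS'
  · exact key S hS hl c

lemma lat_set {d : ℕ} (l : Fin (d+1) → ℤ) (hl : IsLat d l) (hne : l ≠ 0) :
    ∃ S : Finset (Fin (d+1)), S.Nonempty ∧ S ≠ Finset.univ ∧
      (S.card : ℤ) * ((d+1 : ℕ) - S.card) ≤ ∑ i ∈ S, l i := by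
  set m : ℤ := ((d+1 : ℕ) : ℤ) with hm
  have hmpos : 0 < m := by rw [hm]; positivity
  let S : Finset (Fin (d+1)) := Finset.univ.filter fun i => 0 < l i
  have hSm : ∀ i, i ∈ S ↔ 0 < l i := fun i => by simp [S]
  have hsum := hl.1
  have hpos : S.Nonempty := by
    by_contra h
    rw [Finset.not_nonempty_iff_eq_empty] at h
    have h1 : ∀ i, l i ≤ 0 := fun i => by
      by_contra h2
      have : i ∈ S := (hSm i).2 (not_le.1 h2)
      rw [h] at this; simp at this
    have := (Finset.sum_eq_zero_iff_of_nonpos (fun i _ => h1 i)).1 hsum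
    exact hne (funext fun i => this i (Finset.mem_univ i))
  have huniv : S ≠ Finset.univ := by
    intro h
    have h1 : ∀ i, 0 < l i := fun i => (hSm i).1 (by rw [h]; simp)
    have := Finset.sum_pos (fun i _ => h1 i) (Finset.univ_nonempty (α := Fin (d+1)))
    omega
  refine ⟨S, hpos, huniv, ?_⟩
  -- c is the representative in (0, m]
  obtain ⟨c, hc0, hcm, hcd⟩ : ∃ c : ℤ, 0 < c ∧ c ≤ m ∧ ∀ i, m ∣ l i - c := by
    refine ⟨(l 0 - 1) % m + 1, ?_, ?_, fun i => ?_⟩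
    · have := Int.emod_nonneg (l 0 - 1) hmpos.ne'
      omega
    · have := Int.emod_lt_of_pos (l 0 - 1) hmpos
      omega
    · have h1 := hl.2 i 0
      have h2 : m ∣ (l 0 - 1) - (l 0 - 1) % m := Int.dvd_self_sub_emod
      have := dvd_add h1 h2
      rwa [show l i - l 0 + (l 0 - 1 - (l 0 - 1) % m) = l i - ((l 0 - 1) % m + 1) by ring] at this
  have hin : ∀ i ∈ S, c ≤ l i := by
    intro i hi
    obtain ⟨q, hq⟩ := hcd i
    have := (hSm i).1 hi
    have : 0 ≤ q := by
      by_contra h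
      have : q ≤ -1 := by omega
      nlinarith
    nlinarith
  have hout : ∀ i ∈ Sᶜ, l i ≤ c - m := by
    intro i hi
    obtain ⟨q, hq⟩ := hcd i
    have : ¬ 0 < l i := fun h => (Finset.mem_compl.1 hi) ((hSm i).2 h)
    have : q ≤ -1 := by
      by_contra h
      have : 0 ≤ q := by omega
      nlinarith
    nlinarith
  have h1 := Finset.card_nsmul_le_sum S l c hin
  have h2 := Finset.sum_le_card_nsmul Sᶜ l (c - m) hout
  have h3 := Finset.sum_add_sum_compl S l
  rw [hsum] at h3
  have hk : S.card ≤ d + 1 := by simpa using Finset.card_le_univ S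
  have hcc : ((Sᶜ.card : ℕ) : ℤ) = m - S.card := by
    rw [Finset.card_compl, Fintype.card_fin, Nat.cast_sub hk]
  rw [nsmul_eq_mul] at h1 h2
  rw [hcc] at h2
  have hk' : (S.card : ℤ) ≤ m := by rw [hm]; exact_mod_cast hk
  have hk0 : (0 : ℤ) ≤ S.card := by positivity
  rcases le_total (m - S.card) c with h | h
  · nlinarith
  · nlinarith

lemma pp_disj (a : ℝ) {d : ℕ} (u v : Fin d → ℝ) (l : Fin (d+1) → ℤ) (hl : IsLat d l) (hne : l ≠ 0)
    (hu : u ∈ PP a d) (hv : v ∈ PP a d) (huv : ∀ i, ext a u i = l i + ext a v i) :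
    ∃ S : Finset (Fin (d+1)), (S.Nonempty ∧ S ≠ Finset.univ) ∧ ∑ i ∈ S, ext a u i = bd a S.card := by
  obtain ⟨S, h1, h2, h3⟩ := lat_set l hl hne
  refine ⟨S, ⟨h1, h2⟩, le_antisymm (hu.2 S) ?_⟩
  have h4 := hv.2 Sᶜ
  have h5 := Finset.sum_add_sum_compl S (ext a v)
  rw [hv.1] at h5
  have hk : S.card ≤ d + 1 := by simpa using Finset.card_le_univ S
  rw [Finset.card_compl, Fintype.card_fin] at h4
  have h6 : ∑ i ∈ S, ext a u i = ((∑ i ∈ S, l i : ℤ) : ℝ) + ∑ i ∈ S, ext a v i := by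
    rw [Int.cast_sum, ← Finset.sum_add_distrib]
    exact Finset.sum_congr rfl fun i _ => huv i
  have h7 : (S.card : ℝ) * ((d+1 : ℕ) - S.card) ≤ ((∑ i ∈ S, l i : ℤ) : ℝ) := by exact_mod_cast h3
  have h8 : bd a S.card + bd a (d + 1 - S.card) - bd a (d+1) = (S.card : ℝ) * ((d+1 : ℕ) - S.card) := by
    simp only [bd, Nat.cast_sub hk]; ring
  linarith

lemma exists_min {d : ℕ} (w : Fin (d+1) → ℝ) : ∃ z, IsLat d z ∧ ∀ z', IsLat d z' →
    ∑ i, (z i + w i)^2 ≤ ∑ i, (z' i + w i)^2 := by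
  let N : (Fin (d+1) → ℤ) → ℝ := fun z => ∑ i, (z i + w i)^2
  let A : Set (Fin (d+1) → ℤ) := {z | IsLat d z ∧ N z ≤ N 0}
  have h0 : IsLat d 0 := ⟨by simp, by simp⟩
  obtain ⟨B, hB⟩ : ∃ B : ℝ, B = N 0 + 1 := ⟨_, rfl⟩
  have hA : A.Finite := by
    refine (Set.Finite.pi' (t := fun i => Set.Icc ⌊-B - w i⌋ ⌈B - w i⌉)
      (fun i => Set.finite_Icc _ _)).subset ?_
    rintro z ⟨-, hz⟩ i
    have h1 : (z i + w i)^2 ≤ N z :=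
      Finset.single_le_sum (f := fun i => ((z i : ℝ) + w i)^2) (fun i _ => sq_nonneg _) (Finset.mem_univ i)
    have h3 : 0 ≤ N 0 := Finset.sum_nonneg fun i _ => sq_nonneg _
    have h2 : |z i + w i| ≤ B := abs_le_of_sq_le_sq (by nlinarith) (by linarith)
    rw [abs_le] at h2
    constructor
    · have : ((⌊-B - w i⌋ : ℤ) : ℝ) ≤ z i := le_trans (Int.floor_le _) (by linarith)
      exact_mod_cast this
    · have : (z i : ℝ) ≤ ((⌈B - w i⌉ : ℤ) : ℝ) := le_trans (by linarith) (Int.le_ceil _)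
      exact_mod_cast this
  obtain ⟨z, hz, hmin⟩ := Set.exists_min_image A N hA ⟨0, h0, le_rfl⟩
  refine ⟨z, hz.1, fun z' hz' => ?_⟩
  by_cases h : N z' ≤ N 0
  · exact hmin z' ⟨hz', h⟩
  · exact hz.2.trans (not_le.1 h).le

lemma pp_cover (a : ℝ) {d : ℕ} (v : Fin d → ℝ) : ∃ g : Lat d, g +ᵥ v ∈ PP a d := by
  obtain ⟨z, hz, hmin⟩ := exists_min (ext a v)
  refine ⟨⟨fun i => (z i.castSucc : ℝ), z, hz, fun i => rfl⟩, ?_⟩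
  rw [AddSubgroup.vadd_def, vadd_eq_add]
  have hx := ext_add a v (fun i => (z i.castSucc : ℝ)) z hz (fun i => rfl)
  refine ⟨ext_sum a _, fun S => ?_⟩
  have hsum := ext_sum a ((fun i => (z i.castSucc : ℝ)) + v)
  set x := ext a ((fun i => (z i.castSucc : ℝ)) + v) with hxdef
  set k : ℕ := S.card with hk
  let l : Fin (d+1) → ℤ := fun i => (if i ∈ S then ((d+1 : ℕ) : ℤ) else 0) - k
  have hl : IsLat d l := by
    refine ⟨?_, fun i j => ?_⟩
    · simp only [l, Finset.sum_sub_distrib, Finset.sum_ite_mem]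
      simp; ring
    · simp only [l]
      rw [sub_sub_sub_cancel_right]
      refine dvd_sub ?_ ?_ <;> split_ifs <;> simp
  have h := hmin (z + -l) (hz.add hl.neg)
  have e1 : ∑ i, ((z i : ℝ) + ext a v i)^2 = ∑ i, (x i)^2 :=
    Finset.sum_congr rfl fun i _ => by rw [hx]
  have e2 : ∑ i, (((z + -l) i : ℤ) + ext a v i)^2 = ∑ i, (x i)^2
      - 2 * (((d+1 : ℕ) : ℝ) * ∑ i ∈ S, x i - k * bd a (d+1))
      + (k * ((d+1 : ℕ) : ℝ)^2 - 2 * k * k * ((d+1 : ℕ) : ℝ) + ((d+1 : ℕ) : ℝ) * k^2) := by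
    have : ∀ i, (((z + -l) i : ℤ) + ext a v i)^2 = (x i)^2
        - 2 * (((d+1 : ℕ) : ℝ) * (if i ∈ S then x i else 0) - k * x i)
        + ((if i ∈ S then (((d+1 : ℕ) : ℝ)^2 - 2 * k * ((d+1 : ℕ) : ℝ)) else 0) + (k:ℝ)^2) := by
      intro i
      rw [hx]
      simp only [l, Pi.add_apply, Pi.neg_apply]
      split_ifs <;> push_cast <;> ring
    rw [Finset.sum_congr rfl fun i _ => this i, Finset.sum_add_distrib, Finset.sum_sub_distrib,
      ← Finset.mul_sum, Finset.sum_sub_distrib, ← Finset.mul_sum, ← Finset.mul_sum, hsum,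
      Finset.sum_add_distrib, Finset.sum_ite_mem, Finset.sum_ite_mem]
    simp only [Finset.univ_inter, Finset.sum_const, Finset.card_univ, Fintype.card_fin,
      nsmul_eq_mul, ← hk]
    ring
  rw [e1, e2] at h
  have hm : (0:ℝ) < ((d+1 : ℕ) : ℝ) := by positivity
  refine le_of_mul_le_mul_left ?_ hm
  simp only [bd] at h ⊢
  nlinarith

lemma pp_closed (a : ℝ) (d : ℕ) : IsClosed (PP a d) := by
  have hc : ∀ i, Continuous fun y : Fin d → ℝ => ext a y i := by
    intro i
    refine Fin.lastCases ?_ (fun i => ?_) i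
    · simp only [ext, Fin.snoc_last]; fun_prop
    · simp only [ext, Fin.snoc_castSucc]; fun_prop
  have : PP a d = ⋂ S : Finset (Fin (d+1)), {y | ∑ i ∈ S, ext a y i ≤ bd a S.card} := by
    ext y
    simp only [Set.mem_iInter]
    exact ⟨fun h S => h.2 S, fun h => ⟨ext_sum a y, h⟩⟩
  rw [this]
  exact isClosed_iInter fun S => isClosed_le (continuous_finsetSum _ fun i _ => hc i) continuous_const

lemma pp_fd (a : ℝ) (d : ℕ) : IsAddFundamentalDomain (Lat d) (PP a d) volume := by
  refine IsAddFundamentalDomain.mk'' ?_ ?_ ?_ ?_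
  · exact (pp_closed a d).measurableSet.nullMeasurableSet
  · exact Filter.Eventually.of_forall fun x => pp_cover a x
  · intro g hg
    obtain ⟨g, z, hz, hgz⟩ := g
    have hz0 : z ≠ 0 := by
      rintro rfl
      apply hg
      ext i; simp [hgz]
    refine measure_mono_null (t := ⋃ S ∈ {S : Finset (Fin (d+1)) | S.Nonempty ∧ S ≠ Finset.univ},
      {y : Fin d → ℝ | ∑ i ∈ S, ext a y i = bd a S.card}) ?_ ?_
    · rintro u ⟨⟨v, hv, rfl⟩, hu⟩
      obtain ⟨S, hS, hS'⟩ := pp_disj a _ v z hz hz0 hu hv (ext_add a v g z hz hgz)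
      exact Set.mem_biUnion hS hS'
    · rw [measure_biUnion_null_iff (Set.to_countable _)]
      rintro S ⟨h1, h2⟩
      exact null_ext a S h1 h2 _
  · exact fun g => (measurePreserving_vadd g volume).quasiMeasurePreserving

lemma main (a : ℝ) (d : ℕ) :
    permVol (d+1) (permutohedron (d+1) (fun i => a - ((i : ℕ) : ℝ))) * (d+1) = ((d : ℝ) + 1)^d := by
  rw [permVol_eq]
  cases d with
  | zero =>
    have : PP a 0 = Set.univ := by
      refine Set.eq_univ_of_forall fun y => ?_
      obtain ⟨g, hg⟩ := pp_cover a y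
      rwa [Subsingleton.elim y (g +ᵥ y)]
    rw [this, volume_pi, Measure.pi_of_empty]; simp
  | succ e =>
    rw [(pp_fd a (e+1)).measure_eq (box_fd e), box_vol]
    push_cast; ring

end PermVol

/-- the marginal density `l_n` of a coordinate of a uniform random vector
on `Π_n` satisfies `l_n(0) = l_n(1) = (1 - 1/n)^{n-2}`; equivalently, evaluating its
defining formula at the endpoints (`j = 1`, `u = 0` gives the permutohedron
`P_{n-1}(n-1, n-2, …, 2, 1)`; `j = n-1`, `u = 1` gives `P_{n-1}(n-2, n-3, …, 1, 0)`),
`((n-1)/n^{n-2}) · Vol_{n-2}(P_{n-1}(⋯)) = (1 - 1/n)^{n-2}` in both cases. -/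
theorem stmt9 (n : ℕ) (hn : 2 ≤ n) :
    ((((n : ℝ) - 1) / (n : ℝ) ^ (n - 2)) *
        permVol (n - 1) (permutohedron (n - 1) (fun i => (n : ℝ) - 1 - (i : ℕ)))
      = (1 - 1 / (n : ℝ)) ^ (n - 2)) ∧
    ((((n : ℝ) - 1) / (n : ℝ) ^ (n - 2)) *
        permVol (n - 1) (permutohedron (n - 1) (fun i => (n : ℝ) - 2 - (i : ℕ)))
      = (1 - 1 / (n : ℝ)) ^ (n - 2)) := by
  obtain ⟨d, rfl⟩ : ∃ d, n = d + 2 := ⟨n - 2, by omega⟩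
  have key : ∀ a : ℝ, ((((d + 2 : ℕ) : ℝ) - 1) / ((d + 2 : ℕ) : ℝ) ^ (d + 2 - 2)) *
      permVol (d + 2 - 1) (permutohedron (d + 2 - 1) (fun i => a - ((i : ℕ) : ℝ)))
      = (1 - 1 / ((d + 2 : ℕ) : ℝ)) ^ (d + 2 - 2) := by
    intro a
    have h := PermVol.main a d
    have hd : ((d : ℝ) + 2) ≠ 0 := by positivity
    show ((((d + 2 : ℕ) : ℝ) - 1) / ((d + 2 : ℕ) : ℝ) ^ d) *
      permVol (d + 1) (permutohedron (d + 1) (fun i => a - ((i : ℕ) : ℝ)))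
      = (1 - 1 / ((d + 2 : ℕ) : ℝ)) ^ d
    push_cast
    rw [show 1 - 1 / ((d : ℝ) + 2) = (d + 1) / (d + 2) by field_simp; ring, div_pow, ← h]
    ring
  exact ⟨key _, key _⟩
end

section
/- Let ρ_k be the orthonormal shifted Legendre polynomials and ρ_k^{(−1)}(v) = ∫_0^v ρ_k(t) dt their antiderivatives. Then for all integers n, m ≥ 2: √(2n+1) √(2m+1) ∫_0^1 ρ_n^{(−1)}(v) ρ_m^{(−1)}(v) dv equals (2n+1) / (2(2n−1)(2n+3)) if n = m; equals −1 / (4(2·min(n,m)+3)) if |n − m| = 2; and equals 0 otherwise. -/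
/-- The orthonormal shifted Legendre polynomials
`ρ_k(v) = (-1)^k √(2k+1) ∑_{j=0}^k C(k,j) C(k+j,j) (-v)^j`. -/
noncomputable def shiftedLegendre (k : ℕ) (v : ℝ) : ℝ :=
  (-1) ^ k * Real.sqrt (2 * (k : ℝ) + 1) *
    ∑ j ∈ Finset.range (k + 1), (k.choose j : ℝ) * ((k + j).choose j : ℝ) * (-v) ^ j

/-- The antiderivative `ρ_k^{(-1)}(v) = ∫_0^v ρ_k(t) dt`. -/
noncomputable def shiftedLegendreAnti (k : ℕ) (v : ℝ) : ℝ :=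
  ∫ t in (0 : ℝ)..v, shiftedLegendre k t

open Polynomial in
/-- The unnormalised shifted Legendre polynomial, with value `1` at `1`. -/
noncomputable def legP (n : ℕ) : ℝ[X] :=
  C ((-1 : ℝ) ^ n) * (Polynomial.shiftedLegendre n).map (Int.castRingHom ℝ)

open Polynomial in
/-- Integration of a polynomial over `[0,1]`. -/
noncomputable def polyI (f : ℝ[X]) : ℝ := ∫ v in (0 : ℝ)..1, f.eval v

open Polynomial in
lemma polyI_add (f g : ℝ[X]) : polyI (f + g) = polyI f + polyI g := by
  unfold polyI
  simp only [eval_add]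
  exact intervalIntegral.integral_add (f.continuous.intervalIntegrable _ _)
    (g.continuous.intervalIntegrable _ _)

open Polynomial in
lemma polyI_C_mul (c : ℝ) (f : ℝ[X]) : polyI (C c * f) = c * polyI f := by
  unfold polyI
  simp only [eval_mul, eval_C]
  exact intervalIntegral.integral_const_mul _ _

open Polynomial in
lemma poly_ftc (f : ℝ[X]) (v : ℝ) :
    ∫ t in (0 : ℝ)..v, (derivative f).eval t = f.eval v - f.eval 0 :=
  intervalIntegral.integral_eq_sub_of_hasDerivAt (fun x _ => f.hasDerivAt x)
    ((derivative f).continuous.intervalIntegrable _ _)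

open Polynomial in
lemma legP_coeff (n k : ℕ) : (legP n).coeff k
    = (-1) ^ (n + k) * ((n + k).choose (2 * k) * (2 * k).choose k : ℕ) := by
  have h : (n + k).choose (2 * k) * (2 * k).choose k = n.choose k * (n + k).choose n := by
    by_cases hk : k ≤ n
    · rw [Nat.choose_mul (by omega)]
      have h1 : n + k - k = n := by omega
      have h2 : 2 * k - k = k := by omega
      rw [h1, h2, mul_comm, Nat.choose_symm_add]
    · rw [Nat.choose_eq_zero_of_lt (by omega : n + k < 2 * k),
        Nat.choose_eq_zero_of_lt (by omega : n < k)]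
      simp
  rw [h, legP, coeff_C_mul, coeff_map, coeff_shiftedLegendre]
  push_cast
  simp only [eq_intCast]
  push_cast
  ring

lemma choose_key (n k : ℕ) :
    (k + 1) * ((n + k + 3).choose (2 * k + 2) * (2 * k + 2).choose (k + 1))
      = (k + 1) * ((n + k + 1).choose (2 * k + 2) * (2 * k + 2).choose (k + 1))
        + 2 * (2 * n + 3) * ((n + k + 1).choose (2 * k) * (2 * k).choose k) := by
  have hc := Nat.succ_mul_centralBinom_succ k
  simp only [Nat.centralBinom, Nat.mul_add, Nat.mul_one] at hc
  have hp : (n + k + 3).choose (2 * k + 2) = (n + k + 1).choose (2 * k)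
      + 2 * (n + k + 1).choose (2 * k + 1) + (n + k + 1).choose (2 * k + 2) := by
    rw [Nat.choose_succ_succ' (n + k + 2) (2 * k + 1), Nat.choose_succ_succ' (n + k + 1) (2 * k),
      Nat.choose_succ_succ' (n + k + 1) (2 * k + 1)]
    ring
  have hs : (2 * k + 1) * ((n + k + 1).choose (2 * k) + 2 * (n + k + 1).choose (2 * k + 1))
      = (2 * n + 3) * (n + k + 1).choose (2 * k) := by
    have h1 := Nat.choose_succ_right_eq (n + k + 1) (2 * k)
    by_cases hk : 2 * k ≤ n + k + 1
    · obtain ⟨d, hd⟩ := Nat.exists_eq_add_of_le hk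
      have h2 : n + k + 1 - 2 * k = d := by omega
      rw [h2] at h1
      have h3 : 2 * n + 3 = 2 * k + 1 + 2 * d := by omega
      rw [h3]
      linear_combination 2 * h1
    · rw [Nat.choose_eq_zero_of_lt (by omega : n + k + 1 < 2 * k),
        Nat.choose_eq_zero_of_lt (by omega : n + k + 1 < 2 * k + 1)]
      simp
  rw [hp]
  linear_combination ((n + k + 1).choose (2 * k) + 2 * (n + k + 1).choose (2 * k + 1)) * hc
    + 2 * (2 * k).choose k * hs

open Polynomial in
lemma legP_rec (n : ℕ) : derivative (legP (n + 2))
    = derivative (legP n) + C (2 * (2 * (n : ℝ) + 3)) * legP (n + 1) := by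
  ext k
  rw [coeff_add, coeff_C_mul, coeff_derivative, coeff_derivative, legP_coeff, legP_coeff,
    legP_coeff]
  have h := congrArg (Nat.cast : ℕ → ℝ) (choose_key n k)
  have e1 : n + 2 + (k + 1) = n + k + 3 := by ring
  have e2 : n + (k + 1) = n + k + 1 := by ring
  have e3 : n + 1 + k = n + k + 1 := by ring
  have e4 : 2 * (k + 1) = 2 * k + 2 := by ring
  rw [e1, e2, e3, e4]
  push_cast at h ⊢
  linear_combination (-1 : ℝ) ^ (n + k + 1) * h

open Polynomial in
lemma legP_zero' (n : ℕ) : (legP n).eval 0 = (-1) ^ n := by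
  rw [← coeff_zero_eq_eval_zero, legP_coeff]; simp

open Polynomial in
lemma legP_one' (n : ℕ) : (legP n).eval 1 = 1 := by
  have h := shiftedLegendre_eval_symm n (1 : ℝ)
  have h0 := legP_zero' n
  simp only [legP, eval_mul, eval_C, eval_map, sub_self, aeval_def, algebraMap_int_eq] at h h0 ⊢
  rw [h, h0, ← pow_add, ← two_mul, pow_mul]; simp

lemma polyI_parts (f g : Polynomial ℝ) :
    polyI (f.derivative * g) = f.eval 1 * g.eval 1 - f.eval 0 * g.eval 0
      - polyI (f * g.derivative) := by
  have h := poly_ftc (f * g) 1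
  have h2 := polyI_add (f.derivative * g) (f * g.derivative)
  rw [Polynomial.derivative_mul] at h
  rw [← polyI.eq_1 (f.derivative * g + f * g.derivative)] at h
  simp only [Polynomial.eval_mul] at h
  linarith

/-- `∫ f P_{n+1}` through integration by parts. -/
lemma polyI_mul_legP (f : Polynomial ℝ) (n : ℕ) :
    2 * (2 * (n : ℝ) + 3) * polyI (f * legP (n + 1))
      = polyI (f.derivative * legP n) - polyI (f.derivative * legP (n + 2)) := by
  have h1 := polyI_parts f (legP n)
  have h2 := polyI_parts f (legP (n + 2))
  rw [legP_rec, mul_add, polyI_add, mul_left_comm, polyI_C_mul] at h2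
  simp only [legP_zero', legP_one', pow_add] at h1 h2
  linarith

lemma legP_deriv_zero : (legP 0).derivative = 0 := by
  ext k
  rw [Polynomial.coeff_derivative, legP_coeff, Nat.choose_eq_zero_of_lt (by omega)]
  simp

lemma legP_deriv_one : (legP 1).derivative = Polynomial.C 2 * legP 0 := by
  ext k
  rw [Polynomial.coeff_derivative, Polynomial.coeff_C_mul, legP_coeff, legP_coeff]
  rcases k with _ | k
  · norm_num
  · rw [Nat.choose_eq_zero_of_lt (by omega : 1 + (k + 1 + 1) < 2 * (k + 1 + 1)),
      Nat.choose_eq_zero_of_lt (by omega : 0 + (k + 1) < 2 * (k + 1))]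
    simp

lemma polyI_zero_mul (g : Polynomial ℝ) : polyI (0 * g) = 0 := by simp [polyI]

lemma legP_orth_aux (m : ℕ) : (∀ n, m < n → polyI (legP m * legP n) = 0) ∧
    (∀ n, m ≤ n → polyI ((legP m).derivative * legP n) = 0) := by
  induction m using Nat.strong_induction_on with
  | _ m ih =>
    have hd : ∀ n, m ≤ n → polyI ((legP m).derivative * legP n) = 0 := by
      intro n hn
      match m, ih, hn with
      | 0, _, _ => rw [legP_deriv_zero, polyI_zero_mul]
      | 1, ih, hn =>
        rw [legP_deriv_one, mul_assoc, polyI_C_mul, (ih 0 (by omega)).1 n (by omega), mul_zero]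
      | m + 2, ih, hn =>
        rw [legP_rec, add_mul, polyI_add, mul_assoc, polyI_C_mul,
          (ih (m + 1) (by omega)).1 n (by omega), (ih m (by omega)).2 n (by omega)]
        simp
    refine ⟨?_, hd⟩
    intro n hn
    obtain ⟨n, rfl⟩ : ∃ l, n = l + 1 := ⟨n - 1, by omega⟩
    have h := polyI_mul_legP (legP m) n
    rw [hd n (by omega), hd (n + 2) (by omega), sub_zero] at h
    have hp : (2 * (2 * (n : ℝ) + 3)) ≠ 0 := by positivity
    exact (mul_eq_zero.mp h).resolve_left hp

lemma legP_orth (m n : ℕ) (h : m ≠ n) : polyI (legP m * legP n) = 0 := by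
  rcases Nat.lt_or_gt_of_ne h with h | h
  · exact (legP_orth_aux m).1 n h
  · rw [mul_comm]; exact (legP_orth_aux n).1 m h

lemma legP_norm (n : ℕ) : polyI (legP (n + 1) * legP (n + 1)) = 1 / (2 * (n : ℝ) + 3) := by
  have h := polyI_mul_legP (legP (n + 1)) n
  rw [(legP_orth_aux (n + 1)).2 (n + 2) (by omega), polyI_parts, mul_comm (legP (n + 1)) (Polynomial.derivative _),
    (legP_orth_aux n).2 (n + 1) (by omega)] at h
  simp only [legP_zero', legP_one'] at h
  have e : (-1 : ℝ) ^ (n + 1) * (-1) ^ n = -1 := by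
    rw [← pow_add, show n + 1 + n = 2 * n + 1 by ring, pow_succ, pow_mul]; simp
  rw [e] at h
  have hp : (2 * (n : ℝ) + 3) ≠ 0 := by positivity
  rw [eq_div_iff hp]
  linarith

lemma legP_eq (n : ℕ) (v : ℝ) :
    shiftedLegendre n v = Real.sqrt (2 * (n : ℝ) + 1) * (legP n).eval v := by
  have hs : (Polynomial.shiftedLegendre n).map (Int.castRingHom ℝ)
      = ∑ j ∈ Finset.range (n + 1), Polynomial.C
        ((-1 : ℝ) ^ j * (n.choose j : ℝ) * ((n + j).choose n : ℝ)) * Polynomial.X ^ j := by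
    simp [Polynomial.shiftedLegendre, Polynomial.map_sum]
  rw [legP, hs, shiftedLegendre]
  simp only [Polynomial.eval_mul, Polynomial.eval_C, Polynomial.eval_finsetSum,
    Polynomial.eval_pow, Polynomial.eval_X]
  rw [mul_comm ((-1 : ℝ) ^ n), mul_assoc]
  congr 2
  refine Finset.sum_congr rfl fun j _ => ?_
  rw [neg_pow, Nat.choose_symm_add]
  ring

lemma anti_eq (n : ℕ) (v : ℝ) :
    Real.sqrt (2 * ((n + 1 : ℕ) : ℝ) + 1) * shiftedLegendreAnti (n + 1) v
      = (1 / 2) * ((legP (n + 2)).eval v - (legP n).eval v) := by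
  have h2 := poly_ftc (legP (n + 2)) v
  have h0 := poly_ftc (legP n) v
  rw [legP_rec] at h2
  simp only [Polynomial.eval_add, Polynomial.eval_mul, Polynomial.eval_C] at h2
  rw [intervalIntegral.integral_add
    ((Polynomial.continuous _).intervalIntegrable _ _)
    (Continuous.intervalIntegrable (by fun_prop) _ _), h0,
    intervalIntegral.integral_const_mul] at h2
  simp only [legP_zero', pow_add] at h2
  unfold shiftedLegendreAnti
  simp only [legP_eq]
  rw [intervalIntegral.integral_const_mul, ← mul_assoc, Real.mul_self_sqrt (by positivity)]
  push_cast
  linarith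

lemma main_eq (n m : ℕ) :
    Real.sqrt (2 * ((n + 1 : ℕ) : ℝ) + 1) * Real.sqrt (2 * ((m + 1 : ℕ) : ℝ) + 1) *
          ∫ v in (0 : ℝ)..1, shiftedLegendreAnti (n + 1) v * shiftedLegendreAnti (m + 1) v
      = (1 / 4) * (polyI (legP (n + 2) * legP (m + 2)) - polyI (legP (n + 2) * legP m)
        - polyI (legP n * legP (m + 2)) + polyI (legP n * legP m)) := by
  rw [← intervalIntegral.integral_const_mul]
  have e : ∀ v : ℝ, Real.sqrt (2 * ((n + 1 : ℕ) : ℝ) + 1) * Real.sqrt (2 * ((m + 1 : ℕ) : ℝ) + 1)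
      * (shiftedLegendreAnti (n + 1) v * shiftedLegendreAnti (m + 1) v)
      = (Polynomial.C (1 / 4) * ((legP (n + 2) * legP (m + 2)
        + Polynomial.C (-1) * (legP (n + 2) * legP m))
        + (Polynomial.C (-1) * (legP n * legP (m + 2)) + legP n * legP m))).eval v := by
    intro v
    rw [mul_mul_mul_comm, anti_eq, anti_eq]
    simp only [Polynomial.eval_add, Polynomial.eval_mul, Polynomial.eval_C]
    ring
  simp only [e]
  rw [← polyI.eq_1, polyI_C_mul, polyI_add, polyI_add, polyI_add, polyI_C_mul, polyI_C_mul]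
  ring

/-- for `n, m ≥ 2`,
`√(2n+1) √(2m+1) ∫₀¹ ρ_n^{(-1)}(v) ρ_m^{(-1)}(v) dv` equals
`(2n+1)/(2(2n-1)(2n+3))` if `n = m`, `-1/(4(2 min(n,m)+3))` if `|n-m| = 2`, and `0`
otherwise. -/
theorem stmt16 (n m : ℕ) (hn : 2 ≤ n) (hm : 2 ≤ m) :
    (n = m →
      Real.sqrt (2 * (n : ℝ) + 1) * Real.sqrt (2 * (m : ℝ) + 1) *
          ∫ v in (0 : ℝ)..1, shiftedLegendreAnti n v * shiftedLegendreAnti m v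
        = (2 * (n : ℝ) + 1) / (2 * (2 * (n : ℝ) - 1) * (2 * (n : ℝ) + 3))) ∧
    (n + 2 = m ∨ m + 2 = n →
      Real.sqrt (2 * (n : ℝ) + 1) * Real.sqrt (2 * (m : ℝ) + 1) *
          ∫ v in (0 : ℝ)..1, shiftedLegendreAnti n v * shiftedLegendreAnti m v
        = -1 / (4 * (2 * ((min n m : ℕ) : ℝ) + 3))) ∧
    (n ≠ m → ¬(n + 2 = m ∨ m + 2 = n) →
      Real.sqrt (2 * (n : ℝ) + 1) * Real.sqrt (2 * (m : ℝ) + 1) *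
          ∫ v in (0 : ℝ)..1, shiftedLegendreAnti n v * shiftedLegendreAnti m v
        = 0) := by
  obtain ⟨n, rfl⟩ : ∃ l, n = l + 2 := ⟨n - 2, by omega⟩
  obtain ⟨m, rfl⟩ : ∃ l, m = l + 2 := ⟨m - 2, by omega⟩
  rw [main_eq (n + 1) (m + 1)]
  refine ⟨?_, ?_, ?_⟩
  · intro h
    obtain rfl : n = m := by omega
    rw [legP_norm (n + 2), legP_norm n, legP_orth _ _ (by omega), legP_orth _ _ (by omega)]
    push_cast
    have h1 : (2 * ((n : ℝ) + 2) - 1) ≠ 0 := by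
      have : (0 : ℝ) ≤ n := n.cast_nonneg
      intro h; linarith
    have h2 : (2 * (n : ℝ) + 3) ≠ 0 := by positivity
    have h3 : (2 * ((n : ℝ) + 2) + 3) ≠ 0 := by positivity
    have h4 : (2 * ((n : ℝ) + 2) - 1) = 2 * (n : ℝ) + 3 := by ring
    rw [h4]
    field_simp
    ring
  · rintro (h | h)
    · obtain rfl : m = n + 2 := by omega
      rw [legP_orth (n + 1 + 2) (n + 2 + 1 + 2) (by omega), legP_norm (n + 2),
        legP_orth (n + 1) _ (by omega), legP_orth (n + 1) _ (by omega),
        min_eq_left (by omega)]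
      push_cast
      field_simp
      ring
    · obtain rfl : n = m + 2 := by omega
      rw [legP_orth (m + 2 + 1 + 2) _ (by omega), legP_orth (m + 2 + 1 + 2) _ (by omega),
        legP_norm (m + 2), legP_orth (m + 2 + 1) (m + 1) (by omega),
        min_eq_right (by omega)]
      push_cast
      field_simp
      ring
  · intro h1 h2
    rw [legP_orth _ _ (by omega), legP_orth _ _ (by omega), legP_orth _ _ (by omega),
      legP_orth _ _ (by omega)]
    simp
end
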